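/- arXiv:1805.08478 — 2 statements merged into one kernel-verified Lean document; each statement's English description precedes it below -/
import Mathlib

section
/- Let X be a CAT(0) cube complex with at least two vertices, no extremal vertices, and not isomorphic to the standard cubulation of ℝ. A vertex v ∈ X and a point x ∈ ∂X are, respectively, the initial vertex and the endpoint at infinity of a skinny ray if and only if there exist y, z ∈ ∂ₛX such that: (1) m(x,y,z) = v and x op_z y; (2) for every w ∈ ∂ₛX ∖ {x}, the cross ratio triple crt(x,y,z,w) has a representative whose third entry is 0, i.e., crt(x,y,z,w) = ⟪∗:∗:0⟫. -/
/-!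
We use the standard combinatorial model of a CAT(0) cube complex: it is identified
with its vertex set endowed with the combinatorial (ℓ¹) metric, i.e. with a median
graph `G` on a vertex type `V`.  Halfspaces are realised as the vertex sets of the
two sides of the hyperplane dual to an edge, the Roller compactification `X̄` is the
set of ultrafilters of halfspaces, vertices embedding via principal ultrafilters,
and the Roller boundary `∂X` consists of the non-principal ultrafilters.
-/

open scoped ENNReal
open Set

namespace CCCR

variable {V V' : Type*}

/-- The interval between two vertices w.r.t. the combinatorial metric. -/
def vInterval (G : SimpleGraph V) (u v : V) : Set V :=
  {w : V | G.dist u w + G.dist w v = G.dist u v}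

/-- Combinatorial model of a CAT(0) cube complex (identified with its vertex set,
endowed with the combinatorial metric): a connected median graph. -/
def IsCCC (G : SimpleGraph V) : Prop :=
  G.Connected ∧ ∀ x y z : V, ∃! m : V,
    m ∈ vInterval G x y ∧ m ∈ vInterval G y z ∧ m ∈ vInterval G z x

/-- Halfspaces of the cube complex: the sides of the hyperplane dual to an edge. -/
def IsHalfspace (G : SimpleGraph V) (h : Set V) : Prop :=
  ∃ u v : V, G.Adj u v ∧ h = {w : V | G.dist w v < G.dist w u}

/-- The halfspace dual to the (oriented) edge `(u,v)` containing `v`. -/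
def edgeHalf (G : SimpleGraph V) (u v : V) : Set V :=
  {w : V | G.dist w v < G.dist w u}

/-- The hyperplane (wall) dual to the edge `(u,v)`, recorded as its pair of sides. -/
def wallOf (G : SimpleGraph V) (u v : V) : Set (Set V) :=
  {edgeHalf G u v, (edgeHalf G u v)ᶜ}

/-- Two (necessarily distinct) hyperplanes, with respective sides `h` and `k`,
are transverse: all four quarter-spaces are nonempty. -/
def Transv (h k : Set V) : Prop :=
  (h ∩ k).Nonempty ∧ (h ∩ kᶜ).Nonempty ∧ (hᶜ ∩ k).Nonempty ∧ (hᶜ ∩ kᶜ).Nonempty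

/-- An ultrafilter of halfspaces: a point of the Roller compactification X̄.
It contains exactly one side of each hyperplane, and any two members intersect. -/
def IsUltra (G : SimpleGraph V) (σ : Set (Set V)) : Prop :=
  (∀ h ∈ σ, IsHalfspace G h) ∧
  (∀ h : Set V, IsHalfspace G h → (h ∈ σ ↔ hᶜ ∉ σ)) ∧
  (∀ h ∈ σ, ∀ k ∈ σ, (h ∩ k).Nonempty)

/-- The principal ultrafilter of a vertex, i.e. the image of `v` in X̄. -/
def princ (G : SimpleGraph V) (v : V) : Set (Set V) :=
  {h : Set V | IsHalfspace G h ∧ v ∈ h}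

/-- A point of the Roller boundary ∂X = X̄ ∖ X: a non-principal ultrafilter. -/
def IsBdryPt (G : SimpleGraph V) (σ : Set (Set V)) : Prop :=
  IsUltra G σ ∧ ∀ v : V, σ ≠ princ G v

/-- The Roller boundary ∂X as a type. -/
abbrev Bdry (G : SimpleGraph V) : Type _ := {σ : Set (Set V) // IsBdryPt G σ}

/-- The Gromov product (x·y)_v = #𝒲(v | x, y) ∈ ℕ ∪ {+∞}, counted through the
sides containing both x and y but not v. -/
noncomputable def grom (_G : SimpleGraph V) (v : V) (x y : Set (Set V)) : ℕ∞ :=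
  {h : Set V | h ∈ x ∧ h ∈ y ∧ v ∉ h}.encard

/-- The embedding ℕ ∪ {+∞} → ℤ ∪ {±∞}. -/
noncomputable def toE (n : ℕ∞) : EReal := ((n : ℝ≥0∞) : EReal)

/-- The cross ratio cr_v(x,y,z,w) = (x·z)_v + (y·w)_v − (x·w)_v − (y·z)_v ∈ ℤ ∪ {±∞}. -/
noncomputable def crv (G : SimpleGraph V) (v : V) (x y z w : Set (Set V)) : EReal :=
  toE (grom G v x z) + toE (grom G v y w) - toE (grom G v x w) - toE (grom G v y z)

/-- The triple of sums of Gromov products attached to a 4-tuple. -/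
noncomputable def tripod (G : SimpleGraph V) (v : V) (x y z w : Set (Set V)) :
    ℕ∞ × ℕ∞ × ℕ∞ :=
  (grom G v x y + grom G v z w, grom G v x z + grom G v y w, grom G v x w + grom G v y z)

/-- (x,y,z,w) ∈ 𝒜 w.r.t. the basepoint v: at most one of the three sums is infinite. -/
def inA (G : SimpleGraph V) (v : V) (x y z w : Set (Set V)) : Prop :=
  ((tripod G v x y z w).1 ≠ ⊤ ∧ (tripod G v x y z w).2.1 ≠ ⊤) ∨
  ((tripod G v x y z w).1 ≠ ⊤ ∧ (tripod G v x y z w).2.2 ≠ ⊤) ∨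
  ((tripod G v x y z w).2.1 ≠ ⊤ ∧ (tripod G v x y z w).2.2 ≠ ⊤)

/-- (x,y,z,w) ∈ 𝒜 (this is independent of the basepoint). -/
def memA (G : SimpleGraph V) (x y z w : Set (Set V)) : Prop :=
  ∀ v : V, inA G v x y z w

/-- Two triples in (ℕ ∪ {+∞})³ are equivalent if they differ by adding a constant
n ∈ ℕ to all three entries. -/
def TripEquiv (p q : ℕ∞ × ℕ∞ × ℕ∞) : Prop :=
  (∃ n : ℕ, p.1 = q.1 + (n : ℕ∞) ∧ p.2.1 = q.2.1 + (n : ℕ∞) ∧ p.2.2 = q.2.2 + (n : ℕ∞)) ∨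
  (∃ n : ℕ, q.1 = p.1 + (n : ℕ∞) ∧ q.2.1 = p.2.1 + (n : ℕ∞) ∧ q.2.2 = p.2.2 + (n : ℕ∞))

/-- crt(x,y,z,w) = ⟪a:b:c⟫ (the cross ratio triple is independent of the basepoint,
so we require the equality of classes at every basepoint). -/
def crtEq (G : SimpleGraph V) (x y z w : Set (Set V)) (a b c : ℕ∞) : Prop :=
  ∀ v : V, TripEquiv (tripod G v x y z w) (a, b, c)

/-- The median of three points of X̄. -/
def med (x y z : Set (Set V)) : Set (Set V) := (x ∩ y) ∪ (y ∩ z) ∪ (z ∩ x)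

/-- The interval I(x,y) ⊆ X̄ between two points of X̄. -/
def rInterval (G : SimpleGraph V) (x y : Set (Set V)) : Set (Set (Set V)) :=
  {σ : Set (Set V) | IsUltra G σ ∧ x ∩ y ⊆ σ}

/-- `Op G x y z` : x and y are opposite with respect to z, i.e. the median
m = m(x,y,z) lies in X and I(x,y) = I(x,m) ∪ I(m,y). -/
def Op (G : SimpleGraph V) (x y z : Set (Set V)) : Prop :=
  (∃ p : V, med x y z = princ G p) ∧
  rInterval G x y = rInterval G x (med x y z) ∪ rInterval G (med x y z) y

/-- A geodesic ray (based at `r 0`). -/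
def IsGeodRay (G : SimpleGraph V) (r : ℕ → V) : Prop :=
  (∀ n : ℕ, G.Adj (r n) (r (n + 1))) ∧
  ∀ m n : ℕ, m ≤ n → G.dist (r m) (r n) = n - m

/-- A bi-infinite geodesic line. -/
def IsGeodLine (G : SimpleGraph V) (L : ℤ → V) : Prop :=
  (∀ n : ℤ, G.Adj (L n) (L (n + 1))) ∧
  ∀ m n : ℤ, m ≤ n → (G.dist (L m) (L n) : ℤ) = n - m

/-- The set 𝒲(r) of hyperplanes crossed by (the edges of) a ray. -/
def rayWalls (G : SimpleGraph V) (r : ℕ → V) : Set (Set (Set V)) :=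
  {W : Set (Set V) | ∃ n : ℕ, W = wallOf G (r n) (r (n + 1))}

/-- A hyperplane is adjacent to `v` if it is dual to an edge incident to `v`. -/
def WallAdjTo (G : SimpleGraph V) (v : V) (W : Set (Set V)) : Prop :=
  ∃ u : V, G.Adj v u ∧ W = wallOf G v u

/-- A straight ray: no two of the hyperplanes it crosses are transverse. -/
def RayStraight (G : SimpleGraph V) (r : ℕ → V) : Prop :=
  ∀ m n : ℕ, ¬ Transv (edgeHalf G (r m) (r (m + 1))) (edgeHalf G (r n) (r (n + 1)))

/-- A straight line: no two of the hyperplanes it crosses are transverse. -/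
def LineStraight (G : SimpleGraph V) (L : ℤ → V) : Prop :=
  ∀ m n : ℤ, ¬ Transv (edgeHalf G (L m) (L (m + 1))) (edgeHalf G (L n) (L (n + 1)))

/-- The endpoint at infinity r⁺ ∈ ∂X of a ray: the ultrafilter of those halfspaces
containing all but finitely many of its vertices. -/
def rayEnd (G : SimpleGraph V) (r : ℕ → V) : Set (Set V) :=
  {h : Set V | IsHalfspace G h ∧ ∃ N : ℕ, ∀ n : ℕ, N ≤ n → r n ∈ h}

/-- A straight point of the Roller boundary: the endpoint at infinity of a straight ray. -/
def IsStraightPt (G : SimpleGraph V) (x : Set (Set V)) : Prop :=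
  ∃ r : ℕ → V, IsGeodRay G r ∧ RayStraight G r ∧ rayEnd G r = x

/-- x and y are the two endpoints at infinity of the line L. -/
def LineEnds (G : SimpleGraph V) (L : ℤ → V) (x y : Set (Set V)) : Prop :=
  rayEnd G (fun n : ℕ => L (n : ℤ)) = x ∧ rayEnd G (fun n : ℕ => L (-(n : ℤ))) = y

/-- The edges from `v` to `a` and from `v` to `b` span a square. -/
def SpansSquare (G : SimpleGraph V) (v a b : V) : Prop :=
  ∃ w : V, w ≠ v ∧ G.Adj a w ∧ G.Adj b w

/-- An extremal vertex: some edge at `v` spans a square with every other edge at `v`. -/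
def Extremal (G : SimpleGraph V) (v : V) : Prop :=
  ∃ a : V, G.Adj v a ∧ ∀ b : V, G.Adj v b → b ≠ a → SpansSquare G v a b

/-- The cube complex has no extremal vertices. -/
def NoExtremal (G : SimpleGraph V) : Prop := ∀ v : V, ¬ Extremal G v

/-- A skinny vertex: exactly two incident edges. -/
def Skinny (G : SimpleGraph V) (v : V) : Prop := {u : V | G.Adj v u}.encard = 2

/-- A skinny ray: a geodesic ray whose initial vertex has at least three incident
edges and all of whose other vertices are skinny. -/
def IsSkinnyRay (G : SimpleGraph V) (r : ℕ → V) : Prop :=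
  IsGeodRay G r ∧ 3 ≤ {u : V | G.Adj (r 0) u}.encard ∧ ∀ n : ℕ, 1 ≤ n → Skinny G (r n)

/-- (The vertex set of) a cube of the complex: a subset inducing a hypercube graph. -/
def IsCube (G : SimpleGraph V) (c : Set V) : Prop :=
  ∃ (n : ℕ) (e : c ≃ (Fin n → Bool)),
    ∀ a b : c, G.Adj (a : V) (b : V) ↔ ∃! i : Fin n, e a i ≠ e b i

/-- A maximal cube. -/
def IsMaxCube (G : SimpleGraph V) (c : Set V) : Prop :=
  IsCube G c ∧ ∀ c' : Set V, IsCube G c' → c ⊆ c' → c' = c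

/-- Completeness: there is no infinite ascending chain of cubes. -/
def CubeComplete (G : SimpleGraph V) : Prop :=
  ¬ ∃ c : ℕ → Set V, (∀ n : ℕ, IsCube G (c n)) ∧ ∀ n : ℕ, c n ⊂ c (n + 1)

/-- No free faces: no non-maximal cube is contained in a unique maximal cube. -/
def NoFreeFaces (G : SimpleGraph V) : Prop :=
  ∀ c : Set V, IsCube G c → ¬ IsMaxCube G c → ¬ ∃! m : Set V, IsMaxCube G m ∧ c ⊆ m

/-- #𝒲(x, z | y, w): the number of hyperplanes separating x and z from y and w,
counted through the sides containing x and z. -/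
noncomputable def sepCount (x z y w : Set (Set V)) : ℕ∞ :=
  {h : Set V | h ∈ x ∧ h ∈ z ∧ h ∉ y ∧ h ∉ w}.encard

/-- A Möbius map between Roller boundaries: it maps 𝒜(X) into 𝒜(Y) and preserves
cross ratios. -/
def Mobius (G : SimpleGraph V) (G' : SimpleGraph V') (f : Bdry G → Bdry G') : Prop :=
  ∀ x y z w : Bdry G, memA G x.1 y.1 z.1 w.1 →
    memA G' (f x).1 (f y).1 (f z).1 (f w).1 ∧
    ∀ (v : V) (v' : V'),
      crv G' v' (f x).1 (f y).1 (f z).1 (f w).1 = crv G v x.1 y.1 z.1 w.1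

/-- The induced action of a cubical isomorphism on X̄: an ultrafilter is mapped to
the set of images of its halfspaces. -/
def mapUltra (φ : V → V') (σ : Set (Set V)) : Set (Set V') :=
  (fun h : Set V => φ '' h) '' σ

/-- The standard cubulation of ℝ: vertex set ℤ, edges between consecutive integers. -/
def zline : SimpleGraph ℤ := SimpleGraph.fromRel (fun m n => n = m + 1)

end CCCR

namespace CCCR

section helpers
variable {V : Type*} {G : SimpleGraph V}

lemma dcm (G : SimpleGraph V) (a b : V) : G.dist a b = G.dist b a := SimpleGraph.dist_comm

lemma tri (hG : IsCCC G) (a b c : V) : G.dist a c ≤ G.dist a b + G.dist b c :=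
  hG.1.dist_triangle

lemma dadj {u v : V} (h : G.Adj u v) : G.dist u v = 1 := SimpleGraph.dist_eq_one_iff_adj.2 h

lemma d0 (hG : IsCCC G) {u v : V} (h : G.dist u v = 0) : u = v := hG.1.dist_eq_zero_iff.1 h

/-- A neighbour of `q` which is closer to `p`. -/
lemma closer (hG : IsCCC G) {p q : V} (h : p ≠ q) :
    ∃ q', G.Adj q q' ∧ G.dist p q = G.dist p q' + 1 := by
  obtain ⟨W, hW⟩ := hG.1.exists_walk_length_eq_dist q p
  cases W with
  | nil => exact absurd rfl h
  | @cons _ q' _ ha W' =>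
    refine ⟨q', ha, ?_⟩
    have h1 : G.dist q' p ≤ W'.length := SimpleGraph.dist_le W'
    have h2 := tri hG p q' q
    have h3 := dadj ha
    simp only [SimpleGraph.Walk.length_cons] at hW
    rw [dcm G q' p] at h1
    rw [dcm G q p] at hW
    rw [dcm G q q'] at h3
    omega

lemma bip (hG : IsCCC G) {u v : V} (h : G.Adj u v) (w : V) :
    G.dist w u = G.dist w v + 1 ∨ G.dist w v = G.dist w u + 1 := by
  obtain ⟨m, ⟨h1, h2, h3⟩, -⟩ := hG.2 u v w
  simp only [vInterval, mem_ofPred_eq] at h1 h2 h3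
  rw [dadj h] at h1
  have : G.dist u m = 0 ∨ G.dist m v = 0 := by omega
  rcases this with h0 | h0
  · have := d0 hG h0
    subst this
    rw [dcm G v u, dadj h, dcm G u w, dcm G v w] at h2
    omega
  · have := d0 hG h0
    subst this
    rw [dcm G m u, dadj h] at h3
    omega

lemma eh_compl (hG : IsCCC G) {u v : V} (h : G.Adj u v) :
    (edgeHalf G u v)ᶜ = edgeHalf G v u := by
  ext w
  have := bip hG h w
  simp only [edgeHalf, mem_compl_iff, mem_ofPred_eq]
  omega

lemma eh_hs {u v : V} (h : G.Adj u v) : IsHalfspace G (edgeHalf G u v) := ⟨u, v, h, rfl⟩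

lemma hs_compl (hG : IsCCC G) {h : Set V} (hh : IsHalfspace G h) : IsHalfspace G hᶜ := by
  obtain ⟨u, v, ha, rfl⟩ := hh
  exact ⟨v, u, ha.symm, eh_compl hG ha⟩

lemma mem_eh {u v : V} (h : G.Adj u v) : v ∈ edgeHalf G u v := by
  have := dadj h.symm
  simp [edgeHalf, this]

lemma not_mem_eh {u v : V} : u ∉ edgeHalf G u v := by
  simp [edgeHalf]

lemma eh_nbr (hG : IsCCC G) {u v w : V} (h : G.Adj u w) (hw : w ∈ edgeHalf G u v) : w = v := by
  have := dadj h.symm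
  simp only [edgeHalf, mem_ofPred_eq] at hw
  exact d0 hG (by omega)

lemma quad (hG : IsCCC G) {z a b c : V} (ha : G.Adj c a) (hb : G.Adj c b) (hab : a ≠ b)
    (h1 : G.dist z c = G.dist z a + 1) (h2 : G.dist z c = G.dist z b + 1) :
    ∃ d, G.Adj a d ∧ G.Adj b d ∧ G.dist z c = G.dist z d + 2 := by
  obtain ⟨m, ⟨m1, m2, m3⟩, -⟩ := hG.2 a b z
  simp only [vInterval, mem_ofPred_eq] at m1 m2 m3
  have t := tri hG a c b
  rw [dadj ha.symm, dadj hb] at t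
  have hne : G.dist a b ≠ 0 := fun h => hab (d0 hG h)
  have hn1 : G.dist a b ≠ 1 := by
    intro h
    have := bip hG (SimpleGraph.dist_eq_one_iff_adj.1 h) z
    omega
  rw [dcm G b m, dcm G m z, dcm G b z] at m2
  rw [dcm G m a] at m3
  refine ⟨m, SimpleGraph.dist_eq_one_iff_adj.1 ?_, SimpleGraph.dist_eq_one_iff_adj.1 ?_, ?_⟩
  · omega
  · rw [dcm G b m]; omega
  · omega

/-- Opposite edges of a square define the same halfspace (one inclusion). -/
lemma sq_half (hG : IsCCC G) {u v u1 v1 : V} (huv : G.Adj u v) (huu : G.Adj u u1)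
    (hvv : G.Adj v v1) (h11 : G.Adj u1 v1) (hne : v ≠ u1) (hne' : u ≠ v1) (w : V) (hw : w ∈ edgeHalf G u v) :
    w ∈ edgeHalf G u1 v1 := by
  by_contra hc
  simp only [edgeHalf, mem_ofPred_eq] at hw hc
  have b1 := bip hG huv w
  have b2 := bip hG huu w
  have b3 := bip hG hvv w
  have b4 := bip hG h11 w
  have hd : G.dist u v1 = 2 := by
    have t := tri hG u v v1
    rw [dadj huv, dadj hvv] at t
    have h0 : G.dist u v1 ≠ 0 := fun h => hne' (d0 hG h)
    have h1 : G.dist u v1 ≠ 1 := by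
      intro h
      have := bip hG (SimpleGraph.dist_eq_one_iff_adj.1 h) w
      omega
    omega
  obtain ⟨m, -, hu⟩ := hG.2 u v1 w
  have e1 : v = m := by
    apply hu
    simp only [vInterval, mem_ofPred_eq]
    rw [hd, dadj huv, dadj hvv, dadj hvv.symm, dcm G v w, dcm G v1 w,
      dcm G v u, dadj huv]
    omega
  have e2 : u1 = m := by
    apply hu
    simp only [vInterval, mem_ofPred_eq]
    rw [hd, dadj huu, dadj h11, dadj h11.symm, dcm G u1 w, dcm G v1 w,
      dcm G u1 u, dadj huu]
    omega
  exact hne (e1.trans e2.symm)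

lemma sq_half_eq (hG : IsCCC G) {u v u1 v1 : V} (huv : G.Adj u v) (huu : G.Adj u u1)
    (hvv : G.Adj v v1) (h11 : G.Adj u1 v1) (hne : v ≠ u1) (hne' : u ≠ v1) :
    edgeHalf G u v = edgeHalf G u1 v1 := by
  apply Subset.antisymm
  · intro w hw
    exact sq_half hG huv huu hvv h11 hne hne' w hw
  · intro w hw
    exact sq_half hG h11 huu.symm hvv.symm huv hne'.symm hne.symm w hw

/-- Any edge crossing a hyperplane defines it. -/
lemma cross_aux (hG : IsCCC G) (k : ℕ) : ∀ {u v a a' : V}, G.Adj u v → G.Adj a' a →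
    G.dist a v = k → a ∈ edgeHalf G u v → a' ∉ edgeHalf G u v →
    edgeHalf G u v = edgeHalf G a' a := by
  induction k with
  | zero =>
    intro u v a a' huv haa hk ha ha'
    have e := d0 hG hk
    subst e
    have b1 := bip hG huv a'
    have := dadj haa
    simp only [edgeHalf, mem_ofPred_eq] at ha'
    have : a' = u := d0 hG (by omega)
    rw [this]
  | succ k ih =>
    intro u v a a' huv haa hk ha ha'
    have ha0 := ha
    have ha0' := ha'
    simp only [edgeHalf, mem_ofPred_eq] at ha ha'
    have hav : a ≠ v := by
      rintro rfl
      simp at hk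
    obtain ⟨v1, hv1, hd1⟩ := closer hG hav
    have b1 := bip hG huv a
    have b2 := bip hG huv a'
    have b3 := bip hG haa v
    have b4 := bip hG haa u
    have b5 := bip hG haa v1
    have b6 := bip hG hv1 a'
    rw [dcm G v, dcm G v] at b3
    rw [dcm G u, dcm G u] at b4
    rw [dcm G v1, dcm G v1] at b5
    have hne : u ≠ v1 := by
      rintro rfl
      omega
    obtain ⟨u1, h1, h2, h3⟩ := quad hG (z := a') huv.symm hv1 hne (by omega) (by omega)
    have hvu1 : v ≠ u1 := by
      rintro rfl
      omega
    have b7 := bip hG h1 a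
    have b8 := bip hG h2 a
    have b9 := bip hG haa u1
    rw [dcm G u1, dcm G u1] at b9
    have e := sq_half_eq hG huv h1 hv1 h2.symm hvu1 hne
    rw [e] at ha0 ha0' ⊢
    exact ih h2.symm haa (by omega) ha0 ha0'

lemma cross (hG : IsCCC G) {h : Set V} (hh : IsHalfspace G h) {a a' : V} (haa : G.Adj a' a)
    (ha : a ∈ h) (ha' : a' ∉ h) : h = edgeHalf G a' a := by
  obtain ⟨u, v, huv, rfl⟩ := hh
  exact cross_aux hG _ huv haa rfl ha ha'

lemma exit_edge (hG : IsCCC G) {h : Set V} {a : V} (ha : a ∈ h) (k : ℕ) :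
    ∀ c, c ∉ h → G.dist a c = k →
    ∃ p p', p ∈ h ∧ p' ∉ h ∧ G.Adj p' p ∧ G.dist a c = G.dist a p + 1 + G.dist p' c := by
  induction k with
  | zero =>
    intro c hc hd
    rw [← d0 hG hd] at hc
    exact absurd ha hc
  | succ k ih =>
    intro c hc hd
    have hac : a ≠ c := by
      rintro rfl
      exact hc ha
    obtain ⟨c', hc', hd'⟩ := closer hG hac
    by_cases hin : c' ∈ h
    · exact ⟨c', c, hin, hc, hc', by simp [hd']⟩
    · obtain ⟨p, p', hp, hp', hpp, he⟩ := ih c' hin (by omega)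
      refine ⟨p, p', hp, hp', hpp, ?_⟩
      have t := tri hG p' c' c
      rw [dadj hc'.symm] at t
      have t2 := tri hG a p c
      have t3 := tri hG p p' c
      rw [dadj hpp.symm] at t3
      omega

lemma convex (hG : IsCCC G) {h : Set V} (hh : IsHalfspace G h) {a b c : V} (ha : a ∈ h)
    (hb : b ∈ h) (hc : G.dist a c + G.dist c b = G.dist a b) : c ∈ h := by
  by_contra hn
  obtain ⟨p, p', hp, hp', hpp, he⟩ := exit_edge hG ha _ c hn rfl
  have e := cross hG hh hpp hp hp'
  rw [e] at hb
  simp only [edgeHalf, mem_ofPred_eq] at hb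
  have t := tri hG p' c b
  have t2 := tri hG a p b
  rw [dcm G b, dcm G b] at hb
  omega

lemma disj_of_not_sq (hG : IsCCC G) {v a b p : V} (ha : G.Adj v a) (hb : G.Adj v b)
    (hab : a ≠ b) (hs : ¬ SpansSquare G v a b) (hpa : p ∈ edgeHalf G v a)
    (hpb : p ∈ edgeHalf G v b) : False := by
  have b1 := bip hG ha p
  have b2 := bip hG hb p
  simp only [edgeHalf, mem_ofPred_eq] at hpa hpb
  obtain ⟨d, h1, h2, h3⟩ := quad hG (z := p) ha hb hab (by omega) (by omega)
  refine hs ⟨d, ?_, h1, h2⟩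
  rintro rfl
  omega

/-! Ultrafilters -/

lemma ultra_up {σ : Set (Set V)} (hσ : IsUltra G σ) {h k : Set V} (hh : h ∈ σ)
    (hk : IsHalfspace G k) (hs : h ⊆ k) : k ∈ σ := by
  rw [hσ.2.1 k hk]
  intro hc
  obtain ⟨p, hp, hp'⟩ := hσ.2.2 h hh _ hc
  exact hp' (hs hp)

lemma ultra_not {σ : Set (Set V)} (hσ : IsUltra G σ) {h : Set V} (hh : IsHalfspace G h)
    (hn : h ∉ σ) : hᶜ ∈ σ := by
  by_contra hc
  exact hn ((hσ.2.1 h hh).2 hc)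

lemma ultra_eq {σ τ : Set (Set V)} (hσ : IsUltra G σ) (hτ : IsUltra G τ) (hs : σ ⊆ τ) :
    σ = τ := by
  apply Subset.antisymm hs
  intro h hh
  by_contra hn
  have := hs (ultra_not hσ (hτ.1 h hh) hn)
  exact ((hτ.2.1 h (hτ.1 h hh)).1 hh) this

lemma princ_ultra (hG : IsCCC G) (v : V) : IsUltra G (princ G v) := by
  refine ⟨fun h hh => hh.1, ?_, fun h hh k hk => ⟨v, hh.2, hk.2⟩⟩
  intro h hh
  have := hs_compl hG hh
  simp [princ, hh, this]

lemma med_ultra {x y z : Set (Set V)} (hx : IsUltra G x) (hy : IsUltra G y)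
    (hz : IsUltra G z) : IsUltra G (med x y z) := by
  refine ⟨?_, ?_, ?_⟩
  · rintro h ((hh | hh) | hh)
    · exact hx.1 h hh.1
    · exact hy.1 h hh.1
    · exact hz.1 h hh.1
  · intro h hh
    have h1 := hx.2.1 h hh
    have h2 := hy.2.1 h hh
    have h3 := hz.2.1 h hh
    simp only [med, mem_union, mem_inter_iff]
    tauto
  · intro h hh k hk
    simp only [med, mem_union, mem_inter_iff] at hh hk
    have h1 := hx.2.2 h
    have h2 := hy.2.2 h
    have h3 := hz.2.2 h
    have : (h ∈ x ∧ k ∈ x) ∨ (h ∈ y ∧ k ∈ y) ∨ (h ∈ z ∧ k ∈ z) := by tauto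
    rcases this with ⟨a, b⟩ | ⟨a, b⟩ | ⟨a, b⟩
    · exact h1 a k b
    · exact h2 a k b
    · exact h3 a k b

lemma exists_adj_half (hG : IsCCC G) {σ : Set (Set V)} (hσ : IsUltra G σ) {v : V}
    (hv : σ ≠ princ G v) : ∃ u, G.Adj v u ∧ edgeHalf G v u ∈ σ := by
  have : ∃ h ∈ σ, v ∉ h := by
    by_contra hc
    push Not at hc
    exact hv (ultra_eq hσ (princ_ultra hG v) fun h hh => ⟨hσ.1 h hh, hc h hh⟩)
  obtain ⟨h, hh, hvh⟩ := this
  obtain ⟨p0, hp0, -⟩ := hσ.2.2 h hh h hh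
  classical
  have hex : ∃ n, ∃ p ∈ h, G.dist v p = n := ⟨_, p0, hp0, rfl⟩
  obtain ⟨p, hp, hpn⟩ := Nat.find_spec hex
  have hmin : ∀ q ∈ h, G.dist v p ≤ G.dist v q := by
    intro q hq
    rw [hpn]
    exact Nat.find_min' hex ⟨q, hq, rfl⟩
  have hpv : p ≠ v := by
    rintro rfl
    exact hvh hp
  obtain ⟨u, hu, hd⟩ := closer hG hpv
  refine ⟨u, hu, ultra_up hσ hh (eh_hs hu) ?_⟩
  intro q hq
  obtain ⟨m, ⟨m1, m2, m3⟩, -⟩ := hG.2 v p q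
  simp only [vInterval, mem_ofPred_eq] at m1 m2 m3
  have hm := hmin m (convex hG (hσ.1 h hh) hp hq m2)
  have e : m = p := d0 hG (by omega)
  subst e
  simp only [edgeHalf, mem_ofPred_eq]
  have t := tri hG q m u
  omega

/-! Locally straight rays -/

def LocStr (G : SimpleGraph V) (r : ℕ → V) : Prop :=
  (∀ n, G.Adj (r n) (r (n + 1))) ∧
    ∀ n, r n ≠ r (n + 2) ∧ ¬ SpansSquare G (r (n + 1)) (r n) (r (n + 2))

lemma ls_step (hG : IsCCC G) {r : ℕ → V} (hr : LocStr G r) (n : ℕ) :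
    edgeHalf G (r (n + 1)) (r (n + 2)) ⊆ edgeHalf G (r n) (r (n + 1)) := by
  intro p hp
  by_contra hn
  have hn' : p ∈ (edgeHalf G (r n) (r (n + 1)))ᶜ := hn
  rw [eh_compl hG (hr.1 n)] at hn'
  exact disj_of_not_sq hG (hr.1 n).symm (hr.1 (n + 1)) (hr.2 n).1 (hr.2 n).2 hn' hp

lemma ls_anti (hG : IsCCC G) {r : ℕ → V} (hr : LocStr G r) :
    Antitone fun n => edgeHalf G (r n) (r (n + 1)) :=
  antitone_nat_of_succ_le (ls_step hG hr)

lemma ls_mem (hG : IsCCC G) {r : ℕ → V} (hr : LocStr G r) {n m : ℕ} (h : n < m) :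
    r m ∈ edgeHalf G (r n) (r (n + 1)) := by
  obtain ⟨m, rfl⟩ : ∃ k, m = k + 1 := ⟨m - 1, by omega⟩
  exact ls_anti hG hr (show n ≤ m by omega) (mem_eh (hr.1 m))

lemma ls_not_mem (hG : IsCCC G) {r : ℕ → V} (hr : LocStr G r) {n m : ℕ} (h : m ≤ n) :
    r m ∉ edgeHalf G (r n) (r (n + 1)) := fun hc =>
  not_mem_eh (ls_anti hG hr h hc)

lemma ls_geod (hG : IsCCC G) {r : ℕ → V} (hr : LocStr G r) : IsGeodRay G r := by
  refine ⟨hr.1, ?_⟩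
  intro m n hmn
  induction n, hmn using Nat.le_induction with
  | base => simp
  | succ n hmn ih =>
    have h1 := ls_not_mem hG hr hmn
    have h2 := bip hG (hr.1 n) (r m)
    simp only [edgeHalf, mem_ofPred_eq] at h1
    omega

lemma ls_straight (hG : IsCCC G) {r : ℕ → V} (hr : LocStr G r) : RayStraight G r := by
  rintro m n ⟨-, ⟨p, hp, hp'⟩, ⟨q, hq, hq'⟩, -⟩
  rcases le_total m n with h | h
  · exact hq (ls_anti hG hr h hq')
  · exact hp' (ls_anti hG hr h hp)

lemma ls_half_mem (hG : IsCCC G) {r : ℕ → V} (hr : LocStr G r) (n : ℕ) :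
    edgeHalf G (r n) (r (n + 1)) ∈ rayEnd G r :=
  ⟨eh_hs (hr.1 n), n + 1, fun _ hm => ls_mem hG hr (by omega)⟩

/-- Crossing index. -/
lemma ls_cross (hG : IsCCC G) {r : ℕ → V} (hr : LocStr G r) {h : Set V} (hh : IsHalfspace G h)
    {m n : ℕ} (hmn : m ≤ n) (hm : r m ∉ h) (hn : r n ∈ h) :
    ∃ j, m ≤ j ∧ j < n ∧ h = edgeHalf G (r j) (r (j + 1)) := by
  induction n, hmn using Nat.le_induction with
  | base => exact absurd hn hm
  | succ n hmn ih =>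
    by_cases hin : r n ∈ h
    · obtain ⟨j, h1, h2, h3⟩ := ih hin
      exact ⟨j, h1, by omega, h3⟩
    · exact ⟨n, hmn, by omega, cross hG hh (hr.1 n) hn hin⟩

lemma ls_end_half (hG : IsCCC G) {r : ℕ → V} (hr : LocStr G r) {h : Set V}
    (hh : h ∈ rayEnd G r) (hv : r 0 ∉ h) : ∃ j, h = edgeHalf G (r j) (r (j + 1)) := by
  obtain ⟨hs, N, hN⟩ := hh
  obtain ⟨j, -, -, hj⟩ := ls_cross hG hr hs (Nat.zero_le N) hv (hN N le_rfl)
  exact ⟨j, hj⟩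

lemma ls_ultra (hG : IsCCC G) {r : ℕ → V} (hr : LocStr G r) : IsUltra G (rayEnd G r) := by
  refine ⟨fun h hh => hh.1, ?_, ?_⟩
  · intro h hh
    constructor
    · rintro ⟨-, N, hN⟩ ⟨-, M, hM⟩
      exact hM (max N M) (le_max_right _ _) (hN (max N M) (le_max_left _ _))
    · intro hc
      refine ⟨hh, ?_⟩
      by_cases h0 : ∃ m, r m ∈ h
      · obtain ⟨m, hm⟩ := h0
        refine ⟨m, fun n hn => ?_⟩
        by_contra hnn
        obtain ⟨j, h1, h2, h3⟩ := ls_cross hG hr (hs_compl hG hh) hn (by simpa using hm) hnn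
        exact hc (h3 ▸ ls_half_mem hG hr j)
      · push Not at h0
        exact absurd ⟨hs_compl hG hh, 0, fun n _ => h0 n⟩ hc
  · rintro h ⟨-, N, hN⟩ k ⟨-, M, hM⟩
    exact ⟨r (max N M), hN _ (le_max_left _ _), hM _ (le_max_right _ _)⟩

lemma ls_exhaust (hG : IsCCC G) {r : ℕ → V} (hr : LocStr G r) (p : V) :
    ∃ n, p ∉ edgeHalf G (r n) (r (n + 1)) := by
  by_contra hc
  push Not at hc
  have : ∀ n, G.dist p (r n) + n ≤ G.dist p (r 0) := by
    intro n
    induction n with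
    | zero => simp
    | succ n ih =>
      have := hc n
      simp only [edgeHalf, mem_ofPred_eq] at this
      omega
  have := this (G.dist p (r 0) + 1)
  omega

lemma ls_bdry (hG : IsCCC G) {r : ℕ → V} (hr : LocStr G r) : IsBdryPt G (rayEnd G r) := by
  refine ⟨ls_ultra hG hr, fun p hp => ?_⟩
  obtain ⟨n, hn⟩ := ls_exhaust hG hr p
  have := ls_half_mem hG hr n
  rw [hp] at this
  exact hn this.2

lemma ls_straightPt (hG : IsCCC G) {r : ℕ → V} (hr : LocStr G r) :
    IsStraightPt G (rayEnd G r) := ⟨r, ls_geod hG hr, ls_straight hG hr, rfl⟩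

lemma ls_disj (hG : IsCCC G) {r s : ℕ → V} (hr : LocStr G r) (hs : LocStr G s)
    (h0 : r 0 = s 0) (h1 : r 1 ≠ s 1) {h : Set V} (hhr : h ∈ rayEnd G r)
    (hhs : h ∈ rayEnd G s) : r 0 ∈ h := by
  by_contra hc
  obtain ⟨i, hi⟩ := ls_end_half hG hr hhr hc
  have hsub : h ⊆ edgeHalf G (r 0) (r 1) := hi ▸ ls_anti hG hr (Nat.zero_le i)
  have hm : edgeHalf G (r 0) (r 1) ∈ rayEnd G s :=
    ultra_up (ls_ultra hG hs) hhs (eh_hs (hr.1 0)) hsub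
  obtain ⟨j, hj⟩ := ls_end_half hG hs hm (h0 ▸ not_mem_eh)
  have hin : r 1 ∈ edgeHalf G (s 0) (s 1) := by
    have : r 1 ∈ edgeHalf G (r 0) (r 1) := mem_eh (hr.1 0)
    rw [hj] at this
    exact ls_anti hG hs (Nat.zero_le j) this
  exact h1 (eh_nbr hG (h0 ▸ hr.1 0) hin)

/-- A ray built by iterating a step relation on edges. -/
lemma build (P : V → V → Prop) (Q : V → V → V → Prop)
    (step : ∀ p q, P p q → ∃ q', P q q' ∧ Q p q q') {v u : V} (h : P v u) :
    ∃ r : ℕ → V, r 0 = v ∧ r 1 = u ∧ (∀ n, P (r n) (r (n + 1))) ∧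
      ∀ n, Q (r n) (r (n + 1)) (r (n + 2)) := by
  choose f hf using step
  let S : ℕ → {e : V × V // P e.1 e.2} := fun n =>
    Nat.rec ⟨(v, u), h⟩ (fun _ e => ⟨(e.1.2, f e.1.1 e.1.2 e.2), (hf _ _ e.2).1⟩) n
  refine ⟨fun n => (S n).1.1, rfl, rfl, fun n => (S n).2, fun n => (hf _ _ (S n).2).2⟩

lemma exists_ls (hne : NoExtremal G) {v u : V} (h : G.Adj v u) :
    ∃ r, LocStr G r ∧ r 0 = v ∧ r 1 = u := by
  obtain ⟨r, h0, h1, h2, h3⟩ := build (fun p q => G.Adj p q)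
    (fun p q q' => p ≠ q' ∧ ¬ SpansSquare G q p q') (by
      intro p q hpq
      have := hne q
      simp only [Extremal] at this
      push Not at this
      obtain ⟨b, hb, hbp, hs⟩ := this p hpq.symm
      exact ⟨b, hb, hbp.symm, hs⟩) h
  exact ⟨r, ⟨h2, h3⟩, h0, h1⟩

/-! Basepoint independence -/

lemma grom_adj (hG : IsCCC G) {v v' : V} (ha : G.Adj v v') {x y : Set (Set V)}
    (hx : IsUltra G x) (hy : IsUltra G y) :
    ∃ c : ℕ∞,
      ((edgeHalf G v v' ∈ x ∧ edgeHalf G v v' ∈ y → grom G v x y = c + 1) ∧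
       (¬ (edgeHalf G v v' ∈ x ∧ edgeHalf G v v' ∈ y) → grom G v x y = c)) ∧
      ((edgeHalf G v v' ∉ x ∧ edgeHalf G v v' ∉ y → grom G v' x y = c + 1) ∧
       (¬ (edgeHalf G v v' ∉ x ∧ edgeHalf G v v' ∉ y) → grom G v' x y = c)) := by
  have key1 : ∀ h ∈ x, v ∉ h → v' ∈ h → h = edgeHalf G v v' := fun h hh h1 h2 =>
    cross hG (hx.1 h hh) ha h2 h1
  have key2 : ∀ h ∈ x, v' ∉ h → v ∈ h → h = edgeHalf G v' v := fun h hh h1 h2 =>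
    cross hG (hx.1 h hh) ha.symm h2 h1
  have ex := hx.2.1 _ (eh_hs ha)
  have ey := hy.2.1 _ (eh_hs ha)
  rw [eh_compl hG ha] at ex ey
  have m1 := mem_eh ha
  have m2 := mem_eh ha.symm
  have n1 : v ∉ edgeHalf G v v' := not_mem_eh
  have n2 : v' ∉ edgeHalf G v' v := not_mem_eh
  refine ⟨{h : Set V | h ∈ x ∧ h ∈ y ∧ v ∉ h ∧ v' ∉ h}.encard, ⟨?_, ?_⟩, ⟨?_, ?_⟩⟩
  · intro hc
    rw [grom, ← Set.encard_insert_of_notMem (a := edgeHalf G v v') (by simp [m1])]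
    congr 1
    ext h
    simp only [mem_ofPred_eq, mem_insert_iff]
    constructor
    · rintro ⟨h1, h2, h3⟩
      by_cases h4 : v' ∈ h
      · exact Or.inl (key1 h h1 h3 h4)
      · exact Or.inr ⟨h1, h2, h3, h4⟩
    · rintro (rfl | ⟨h1, h2, h3, h4⟩)
      · exact ⟨hc.1, hc.2, n1⟩
      · exact ⟨h1, h2, h3⟩
  · intro hc
    rw [grom]
    congr 1
    ext h
    simp only [mem_ofPred_eq]
    constructor
    · rintro ⟨h1, h2, h3⟩
      refine ⟨h1, h2, h3, fun h4 => hc ?_⟩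
      rw [← key1 h h1 h3 h4]
      exact ⟨h1, h2⟩
    · rintro ⟨h1, h2, h3, h4⟩
      exact ⟨h1, h2, h3⟩
  · intro hc
    rw [grom, ← Set.encard_insert_of_notMem (a := edgeHalf G v' v) (by simp [m2])]
    congr 1
    ext h
    simp only [mem_ofPred_eq, mem_insert_iff]
    constructor
    · rintro ⟨h1, h2, h3⟩
      by_cases h4 : v ∈ h
      · exact Or.inl (key2 h h1 h3 h4)
      · exact Or.inr ⟨h1, h2, h4, h3⟩
    · rintro (rfl | ⟨h1, h2, h3, h4⟩)
      · exact ⟨by tauto, by tauto, n2⟩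
      · exact ⟨h1, h2, h4⟩
  · intro hc
    rw [grom]
    congr 1
    ext h
    simp only [mem_ofPred_eq]
    constructor
    · rintro ⟨h1, h2, h3⟩
      refine ⟨h1, h2, fun h4 => hc ?_, h3⟩
      have e := key2 h h1 h3 h4
      rw [e] at h1 h2
      tauto
    · rintro ⟨h1, h2, h3, h4⟩
      exact ⟨h1, h2, h4⟩

def Rel (p q : ℕ∞ × ℕ∞ × ℕ∞) : Prop :=
  ∃ n m : ℕ, p.1 + n = q.1 + m ∧ p.2.1 + n = q.2.1 + m ∧ p.2.2 + n = q.2.2 + m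

lemma Rel.trans' {p q s : ℕ∞ × ℕ∞ × ℕ∞} (h : Rel p q) (h' : Rel q s) : Rel p s := by
  obtain ⟨n, m, a, b, c⟩ := h
  obtain ⟨n', m', a', b', c'⟩ := h'
  have aux : ∀ {p q s : ℕ∞}, p + n = q + m → q + n' = s + m' →
      p + ((n + n' : ℕ) : ℕ∞) = s + ((m' + m : ℕ) : ℕ∞) := by
    intro p q s h h'
    push_cast
    rw [← add_assoc, h, add_right_comm, h', add_assoc]
  exact ⟨n + n', m' + m, aux a a', aux b b', aux c c'⟩

lemma cancel_aux {p q : ℕ∞} {n k : ℕ} (h : p + n = q + ((n + k : ℕ) : ℕ∞)) : p = q + k := by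
  push_cast at h
  rw [add_comm (n : ℕ∞) k, ← add_assoc] at h
  exact (ENat.add_left_injective_of_ne_top (ENat.natCast_ne_top n)) h

lemma Rel.tripEquiv {p q : ℕ∞ × ℕ∞ × ℕ∞} (h : Rel p q) : TripEquiv p q := by
  obtain ⟨n, m, a, b, c⟩ := h
  rcases le_total n m with h | h
  · obtain ⟨k, rfl⟩ := Nat.exists_eq_add_of_le h
    exact Or.inl ⟨k, cancel_aux a, cancel_aux b, cancel_aux c⟩
  · obtain ⟨k, rfl⟩ := Nat.exists_eq_add_of_le h
    exact Or.inr ⟨k, cancel_aux a.symm, cancel_aux b.symm, cancel_aux c.symm⟩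

lemma rel_adj (hG : IsCCC G) {v v' : V} (ha : G.Adj v v') {x y z w : Set (Set V)}
    (hx : IsUltra G x) (hy : IsUltra G y) (hz : IsUltra G z) (hw : IsUltra G w) :
    Rel (tripod G v x y z w) (tripod G v' x y z w) := by
  obtain ⟨c1, ⟨a1, a2⟩, a3, a4⟩ := grom_adj hG ha hx hy
  obtain ⟨c2, ⟨b1, b2⟩, b3, b4⟩ := grom_adj hG ha hz hw
  obtain ⟨c3, ⟨d1, d2⟩, d3, d4⟩ := grom_adj hG ha hx hz
  obtain ⟨c4, ⟨e1, e2⟩, e3, e4⟩ := grom_adj hG ha hy hw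
  obtain ⟨c5, ⟨f1, f2⟩, f3, f4⟩ := grom_adj hG ha hx hw
  obtain ⟨c6, ⟨g1, g2⟩, g3, g4⟩ := grom_adj hG ha hy hz
  classical
  by_cases k1 : edgeHalf G v v' ∈ x <;> by_cases k2 : edgeHalf G v v' ∈ y <;>
  by_cases k3 : edgeHalf G v v' ∈ z <;> by_cases k4 : edgeHalf G v v' ∈ w <;>
  simp only [k1, k2, k3, k4, and_self, and_true, and_false, not_true_eq_false,
    not_false_eq_true, forall_const, false_imp_iff] at a1 a2 a3 a4 b1 b2 b3 b4 d1 d2 d3 d4 e1 e2 e3 e4 f1 f2 f3 f4 g1 g2 g3 g4 <;>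
  refine ⟨2, (if edgeHalf G v v' ∈ x then 1 else 0) + (if edgeHalf G v v' ∈ y then 1 else 0)
    + (if edgeHalf G v v' ∈ z then 1 else 0) + (if edgeHalf G v v' ∈ w then 1 else 0), ?_⟩ <;>
  simp only [tripod, *, if_true, if_false] <;>
  refine ⟨?_, ?_, ?_⟩ <;> push_cast <;> ring

lemma rel_all (hG : IsCCC G) (v v' : V) {x y z w : Set (Set V)}
    (hx : IsUltra G x) (hy : IsUltra G y) (hz : IsUltra G z) (hw : IsUltra G w) :
    Rel (tripod G v x y z w) (tripod G v' x y z w) := by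
  obtain ⟨W⟩ := hG.1.preconnected v v'
  induction W with
  | nil => exact ⟨0, 0, rfl, rfl, rfl⟩
  | cons ha _ ih => exact (rel_adj hG ha hx hy hz hw).trans' ih

lemma grom_zero {v : V} {x y : Set (Set V)} :
    grom G v x y = 0 ↔ ∀ h ∈ x, h ∈ y → v ∈ h := by
  rw [grom, Set.encard_eq_zero, Set.eq_empty_iff_forall_notMem]
  simp only [mem_ofPred_eq, not_and, not_not]

/-! Forward direction -/

lemma skinny_nbr {v a b : V} (h : Skinny G v) (ha : G.Adj v a) (hb : G.Adj v b) (hab : a ≠ b)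
    {c : V} (hc : G.Adj v c) : c = a ∨ c = b := by
  obtain ⟨s, t, hst, he⟩ := Set.encard_eq_two.1 h
  have h1 : a ∈ ({s, t} : Set V) := he ▸ ha
  have h2 : b ∈ ({s, t} : Set V) := he ▸ hb
  have h3 : c ∈ ({s, t} : Set V) := he ▸ hc
  simp only [mem_insert_iff, mem_singleton_iff] at h1 h2 h3
  grind

lemma skinny_ls (hne : NoExtremal G) {r : ℕ → V} (hr : IsSkinnyRay G r) : LocStr G r := by
  obtain ⟨⟨h1, h2⟩, -, h3⟩ := hr
  refine ⟨h1, fun n => ?_⟩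
  have hn : r n ≠ r (n + 2) := by
    intro h
    have := h2 n (n + 2) (by omega)
    rw [← h] at this
    simp at this
  refine ⟨hn, fun hs => hne (r (n + 1)) ⟨r n, (h1 n).symm, fun b hb hbn => ?_⟩⟩
  rcases skinny_nbr (h3 (n + 1) (by omega)) (h1 n).symm (h1 (n + 1)) hn hb with rfl | rfl
  · exact absurd rfl hbn
  · exact hs

lemma skinny_half (hG : IsCCC G) (hne : NoExtremal G) {r : ℕ → V} (hr : IsSkinnyRay G r)
    (n : ℕ) (p : V) (hp : p ∈ edgeHalf G (r n) (r (n + 1))) : ∃ m, n < m ∧ p = r m := by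
  have hl := skinny_ls hne hr
  classical
  have hex := ls_exhaust hG hl p
  have hlt : n < Nat.find hex := by
    by_contra hc
    push Not at hc
    exact Nat.find_spec hex (ls_anti hG hl hc hp)
  obtain ⟨m, hm⟩ : ∃ m, Nat.find hex = m + 1 := ⟨Nat.find hex - 1, by omega⟩
  have h1 : p ∉ edgeHalf G (r (m + 1)) (r (m + 1 + 1)) := by
    have := Nat.find_spec hex
    rwa [hm] at this
  have h2 : p ∈ edgeHalf G (r m) (r (m + 1)) := not_not.1 (Nat.find_min hex (m := m) (by omega))
  refine ⟨m + 1, by omega, ?_⟩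
  by_contra hne'
  obtain ⟨q, hq, hd⟩ := closer hG hne'
  simp only [edgeHalf, mem_ofPred_eq] at h1 h2
  rcases skinny_nbr (hr.2.2 (m + 1) (by omega)) (hl.1 m).symm (hl.1 (m + 1)) (hl.2 m).1 hq with
    rfl | rfl <;> omega

lemma skinny_unique (hG : IsCCC G) (hne : NoExtremal G) {r : ℕ → V} (hr : IsSkinnyRay G r)
    {w : Set (Set V)} (hw : IsBdryPt G w) (h0 : edgeHalf G (r 0) (r 1) ∈ w) :
    w = rayEnd G r := by
  have hl := skinny_ls hne hr
  by_cases hall : ∀ n, edgeHalf G (r n) (r (n + 1)) ∈ w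
  · symm
    apply ultra_eq (ls_ultra hG hl) hw.1
    rintro k ⟨hk, N, hN⟩
    refine ultra_up hw.1 (hall N) hk ?_
    intro p hp
    obtain ⟨m, hm, rfl⟩ := skinny_half hG hne hr N p hp
    exact hN m hm.le
  · exfalso
    have : ∃ n, edgeHalf G (r n) (r (n + 1)) ∈ w ∧ edgeHalf G (r (n + 1)) (r (n + 2)) ∉ w := by
      by_contra hc
      push Not at hc
      exact hall fun n => by
        induction n with
        | zero => exact h0
        | succ n ih => exact hc n ih
    obtain ⟨n, hn, hn'⟩ := this
    apply hw.2 (r (n + 1))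
    apply ultra_eq hw.1 (princ_ultra hG _)
    intro k hk
    refine ⟨hw.1.1 k hk, ?_⟩
    by_contra hc
    obtain ⟨p, hp, hp'⟩ := hw.1.2.2 k hk _ hn
    obtain ⟨m, hm, rfl⟩ := skinny_half hG hne hr n p hp'
    obtain ⟨j, hj, -, hj'⟩ := ls_cross hG hl (hw.1.1 k hk) (show n + 1 ≤ m by omega) hc hp
    apply hn'
    refine ultra_up hw.1 hk (eh_hs (hl.1 _)) ?_
    rw [hj']
    exact ls_anti hG hl hj

lemma forward (hG : IsCCC G) (hne : NoExtremal G) {r : ℕ → V} (hr : IsSkinnyRay G r) :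
      ∃ y z : Set (Set V), IsBdryPt G y ∧ IsBdryPt G z ∧
        IsStraightPt G y ∧ IsStraightPt G z ∧
        med (rayEnd G r) y z = princ G (r 0) ∧ Op G (rayEnd G r) y z ∧
        ∀ w : Set (Set V), IsBdryPt G w → IsStraightPt G w → w ≠ rayEnd G r →
          ∃ a b : ℕ∞, crtEq G (rayEnd G r) y z w a b 0 := by
  have hl := skinny_ls hne hr
  have hU := ls_ultra hG hl
  obtain ⟨a, b, ha, hb, hab, ha1, hb1⟩ : ∃ a b, G.Adj (r 0) a ∧ G.Adj (r 0) b ∧ a ≠ b ∧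
      a ≠ r 1 ∧ b ≠ r 1 := by
    by_contra hc
    push Not at hc
    by_cases h1 : ∃ a, G.Adj (r 0) a ∧ a ≠ r 1
    · obtain ⟨a, ha, ha1⟩ := h1
      have : {u : V | G.Adj (r 0) u} ⊆ {a, r 1} := by
        intro b hb
        by_cases hab : a = b
        · exact Or.inl hab.symm
        · exact Or.inr (hc a b ha hb hab ha1)
      have h3 := hr.2.1.trans ((Set.encard_le_encard this).trans (Set.encard_pair ha1).le)
      norm_num at h3
    · push Not at h1
      have : {u : V | G.Adj (r 0) u} ⊆ {r 1} := fun b hb => h1 b hb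
      have h3 := hr.2.1.trans (Set.encard_le_encard this)
      norm_num at h3
  obtain ⟨s, hs, hs0, hs1⟩ := exists_ls hne ha
  obtain ⟨t, ht, ht0, ht1⟩ := exists_ls hne hb
  have hUs := ls_ultra hG hs
  have hUt := ls_ultra hG ht
  have drs : ∀ h ∈ rayEnd G r, h ∈ rayEnd G s → r 0 ∈ h := fun h h1 h2 =>
    ls_disj hG hl hs hs0.symm (by rw [hs1]; exact ha1.symm) h1 h2
  have drt : ∀ h ∈ rayEnd G r, h ∈ rayEnd G t → r 0 ∈ h := fun h h1 h2 =>
    ls_disj hG hl ht ht0.symm (by rw [ht1]; exact hb1.symm) h1 h2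
  have dst : ∀ h ∈ rayEnd G s, h ∈ rayEnd G t → r 0 ∈ h := fun h h1 h2 =>
    hs0 ▸ ls_disj hG hs ht (hs0.trans ht0.symm) (by rw [hs1, ht1]; exact hab) h1 h2
  have hmed : med (rayEnd G r) (rayEnd G s) (rayEnd G t) = princ G (r 0) := by
    apply ultra_eq (med_ultra hU hUs hUt) (princ_ultra hG _)
    rintro h ((hh | hh) | hh)
    · exact ⟨hU.1 h hh.1, drs h hh.1 hh.2⟩
    · exact ⟨hUs.1 h hh.1, dst h hh.1 hh.2⟩
    · exact ⟨hU.1 h hh.2, drt h hh.2 hh.1⟩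
  have hnsq : ¬ SpansSquare G (r 0) (r 1) a := by
    rintro ⟨d, hd0, hd1, hda⟩
    rcases skinny_nbr (hr.2.2 1 le_rfl) (hl.1 0).symm (hl.1 1) (hl.2 0).1 hd1 with rfl | rfl
    · exact hd0 rfl
    · exact (hl.2 0).2 ⟨a, ha1, ha, hda.symm⟩
  refine ⟨rayEnd G s, rayEnd G t, ls_bdry hG hs, ls_bdry hG ht, ls_straightPt hG hs,
    ls_straightPt hG ht, hmed, ⟨⟨r 0, hmed⟩, ?_⟩, ?_⟩
  · rw [hmed]
    apply Subset.antisymm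
    · rintro σ ⟨hσ, hsub⟩
      by_contra hc
      simp only [rInterval, mem_union, mem_ofPred_eq, hσ, true_and, not_or, not_subset] at hc
      obtain ⟨⟨k, ⟨hk1, hk2⟩, hk3⟩, ⟨l, ⟨hl1, hl2⟩, hl3⟩⟩ := hc
      have hks : kᶜ ∈ rayEnd G s := ultra_not hUs hk2.1 fun h => hk3 (hsub ⟨hk1, h⟩)
      have hlr : lᶜ ∈ rayEnd G r := ultra_not hU hl1.1 fun h => hl3 (hsub ⟨h, hl2⟩)
      obtain ⟨i, hi⟩ := ls_end_half hG hs hks (by rw [hs0]; exact not_not.2 hk2.2)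
      obtain ⟨j, hj⟩ := ls_end_half hG hl hlr (not_not.2 hl1.2)
      obtain ⟨p, hp, hp'⟩ := hσ.2.2 _ (ultra_not hσ hk2.1 hk3) _ (ultra_not hσ hl1.1 hl3)
      rw [hi] at hp
      rw [hj] at hp'
      have q1 := ls_anti hG hs (Nat.zero_le i) hp
      have q2 := ls_anti hG hl (Nat.zero_le j) hp'
      simp only [zero_add, hs0, hs1] at q1 q2
      exact disj_of_not_sq hG (hl.1 0) ha ha1.symm hnsq q2 q1
    · rintro σ (⟨hσ, hsub⟩ | ⟨hσ, hsub⟩)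
      · exact ⟨hσ, fun h hh => hsub ⟨hh.1, hU.1 h hh.1, drs h hh.1 hh.2⟩⟩
      · exact ⟨hσ, fun h hh => hsub ⟨⟨hU.1 h hh.1, drs h hh.1 hh.2⟩, hh.2⟩⟩
  · intro w hw _ hwx
    refine ⟨(tripod G (r 0) (rayEnd G r) (rayEnd G s) (rayEnd G t) w).1,
      (tripod G (r 0) (rayEnd G r) (rayEnd G s) (rayEnd G t) w).2.1, fun v' => ?_⟩
    have h3 : (tripod G (r 0) (rayEnd G r) (rayEnd G s) (rayEnd G t) w).2.2 = 0 := by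
      have e1 : grom G (r 0) (rayEnd G r) w = 0 := by
        rw [grom_zero]
        intro h h1 h2
        by_contra hc
        obtain ⟨j, hj⟩ := ls_end_half hG hl h1 hc
        apply hwx
        refine skinny_unique hG hne hr hw (ultra_up hw.1 h2 (eh_hs (hl.1 0)) ?_)
        rw [hj]
        exact ls_anti hG hl (Nat.zero_le j)
      have e2 : grom G (r 0) (rayEnd G s) (rayEnd G t) = 0 := grom_zero.2 dst
      simp [tripod, e1, e2]
    have := (rel_all hG v' (r 0) hU hUs hUt hw.1).tripEquiv
    rw [← h3]
    exact this

/-! Backward direction -/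

lemma backward (hG : IsCCC G) (hne : NoExtremal G) (v : V)
    {x y z : Set (Set V)} (hx : IsBdryPt G x) (hy : IsBdryPt G y) (hz : IsBdryPt G z)
    (hmed : med x y z = princ G v) (hop : Op G x y z)
    (hcr : ∀ w : Set (Set V), IsBdryPt G w → IsStraightPt G w → w ≠ x →
          ∃ a b : ℕ∞, crtEq G x y z w a b 0) :
    ∃ r : ℕ → V, IsSkinnyRay G r ∧ r 0 = v ∧ rayEnd G r = x := by
  have dxy : ∀ h ∈ x, h ∈ y → v ∈ h := fun h h1 h2 => by
    have : h ∈ med x y z := Or.inl (Or.inl ⟨h1, h2⟩)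
    rw [hmed] at this
    exact this.2
  have dyz : ∀ h ∈ y, h ∈ z → v ∈ h := fun h h1 h2 => by
    have : h ∈ med x y z := Or.inl (Or.inr ⟨h1, h2⟩)
    rw [hmed] at this
    exact this.2
  have dxz : ∀ h ∈ x, h ∈ z → v ∈ h := fun h h1 h2 => by
    have : h ∈ med x y z := Or.inr ⟨h2, h1⟩
    rw [hmed] at this
    exact this.2
  have B1 : ∀ h ∈ x, ∀ k ∈ y, v ∉ h → v ∉ k → ¬ (h ∩ k).Nonempty := by
    rintro h hh k hk hvh hvk ⟨p, hp1, hp2⟩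
    have hp := princ_ultra hG p
    have hσ := med_ultra hx.1 hy.1 hp
    have hin : med x y (princ G p) ∈ rInterval G x y := ⟨hσ, fun l hl => Or.inl (Or.inl hl)⟩
    have hhσ : h ∈ med x y (princ G p) := Or.inr ⟨⟨hx.1.1 h hh, hp1⟩, hh⟩
    have hkσ : k ∈ med x y (princ G p) := Or.inl (Or.inr ⟨hk, ⟨hy.1.1 k hk, hp2⟩⟩)
    rw [hop.2, hmed] at hin
    rcases hin with ⟨-, hs⟩ | ⟨-, hs⟩
    · have : kᶜ ∈ x := ultra_not hx.1 (hy.1.1 k hk) fun h => hvk (dxy k h hk)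
      exact (hσ.2.1 k (hy.1.1 k hk)).1 hkσ (hs ⟨this, hs_compl hG (hy.1.1 k hk), hvk⟩)
    · have : hᶜ ∈ y := ultra_not hy.1 (hx.1.1 h hh) fun h' => hvh (dxy h hh h')
      exact (hσ.2.1 h (hx.1.1 h hh)).1 hhσ (hs ⟨⟨hs_compl hG (hx.1.1 h hh), hvh⟩, this⟩)
  have B2 : ∀ w, IsBdryPt G w → IsStraightPt G w → ∀ h ∈ x, h ∈ w → v ∉ h → w = x := by
    intro w hw hws h h1 h2 hv
    by_contra hwx
    obtain ⟨a, b, hab⟩ := hcr w hw hws hwx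
    have hT := hab v
    have e0 : grom G v x w ≠ 0 := fun h0 => hv (grom_zero.1 h0 h h1 h2)
    have e1 : grom G v x z = 0 := grom_zero.2 dxz
    have e2 : grom G v y z = 0 := grom_zero.2 dyz
    have e3 : grom G v y w ≠ 0 := by
      intro e3
      simp only [TripEquiv, tripod, e1, e2, e3, add_zero, zero_add] at hT
      rcases hT with ⟨n, -, q1, q2⟩ | ⟨n, -, q1, q2⟩
      · have := (add_eq_zero.1 q1.symm).2
        rw [this] at q2
        exact e0 q2
      · exact e0 (add_eq_zero.1 q2.symm).1
    apply e3
    rw [grom_zero]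
    intro k hk1 hk2
    by_contra hvk
    exact B1 h h1 k hk1 hv hvk (hw.1.2.2 h h2 k hk2)
  obtain ⟨u, hu, hux⟩ := exists_adj_half hG hx.1 (hx.2 v)
  obtain ⟨a, ha, hay⟩ := exists_adj_half hG hy.1 (hy.2 v)
  obtain ⟨b, hb, hbz⟩ := exists_adj_half hG hz.1 (hz.2 v)
  have hua : u ≠ a := by
    rintro rfl
    exact not_mem_eh (dxy _ hux hay)
  have hub : u ≠ b := by
    rintro rfl
    exact not_mem_eh (dxz _ hux hbz)
  have hab : a ≠ b := by
    rintro rfl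
    exact not_mem_eh (dyz _ hay hbz)
  obtain ⟨r, h0, h1, hP, hQ⟩ := build
    (fun p q => G.Adj p q ∧ edgeHalf G p q ∈ x ∧
      ∀ w, IsBdryPt G w → IsStraightPt G w → edgeHalf G p q ∈ w → w = x)
    (fun p q q' => (p ≠ q' ∧ ¬ SpansSquare G q p q') ∧ ∀ c, G.Adj q c → c = p ∨ c = q') (by
      rintro p q ⟨hpq, hpx, huniq⟩
      have := hne q
      simp only [Extremal] at this
      push Not at this
      obtain ⟨q', hq', hqp, hsq⟩ := this p hpq.symm
      have stay : ∀ r, LocStr G r → r 0 = q → r 1 ≠ p → rayEnd G r = x := by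
        intro r hr hr0 hr1
        refine huniq _ (ls_bdry hG hr) (ls_straightPt hG hr) ?_
        by_contra hc
        have hc' := ultra_not (ls_ultra hG hr) (eh_hs hpq) hc
        rw [eh_compl hG hpq] at hc'
        obtain ⟨j, hj⟩ := ls_end_half hG hr hc' (by rw [hr0]; exact not_mem_eh)
        have hm := mem_eh hpq.symm
        rw [hj] at hm
        have hm' := ls_anti hG hr (Nat.zero_le j) hm
        exact hr1 (eh_nbr hG (hr0 ▸ hpq.symm) hm').symm
      obtain ⟨s, hs, hs0, hs1⟩ := exists_ls hne hq'
      have hsx := stay s hs hs0 (by rw [hs1]; exact hqp)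
      have hsub : edgeHalf G q q' ⊆ edgeHalf G p q := by
        intro o ho
        by_contra hn
        have hn' : o ∈ (edgeHalf G p q)ᶜ := hn
        rw [eh_compl hG hpq] at hn'
        exact disj_of_not_sq hG hpq.symm hq' hqp.symm hsq hn' ho
      refine ⟨q', ⟨hq', ?_, ?_⟩, ⟨hqp.symm, hsq⟩, ?_⟩
      · have := ls_half_mem hG hs 0
        rw [zero_add, hs0, hs1, hsx] at this
        exact this
      · intro w hw hws hin
        exact huniq w hw hws (ultra_up hw.1 hin (eh_hs hpq) hsub)
      · intro c hc
        by_contra hn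
        push Not at hn
        obtain ⟨t, ht, ht0, ht1⟩ := exists_ls hne hc
        have htx := stay t ht ht0 (by rw [ht1]; exact hn.1)
        have hm := ls_half_mem hG hs 0
        have := ls_disj hG hs ht (hs0.trans ht0.symm) (by rw [hs1, ht1]; exact hn.2.symm) hm
          (by rw [htx, ← hsx]; exact hm)
        exact not_mem_eh this)
    (v := v) (u := u) ⟨hu, hux, fun w hw hws hin => B2 w hw hws _ hux hin not_mem_eh⟩
  have hl : LocStr G r := ⟨fun n => (hP n).1, fun n => (hQ n).1⟩
  refine ⟨r, ⟨ls_geod hG hl, ?_, ?_⟩, h0, ?_⟩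
  · rw [h0]
    have hsub : ({u, a, b} : Set V) ⊆ {c : V | G.Adj v c} := by
      rintro c (rfl | rfl | rfl) <;> assumption
    refine le_trans (le_of_eq ?_) (Set.encard_le_encard hsub)
    exact (Set.encard_eq_three.2 ⟨u, a, b, hua, hub, hab, rfl⟩).symm
  · intro n hn
    obtain ⟨n, rfl⟩ : ∃ k, n = k + 1 := ⟨n - 1, by omega⟩
    refine Set.encard_eq_two.2 ⟨r n, r (n + 2), (hQ n).1.1, ?_⟩
    ext c
    simp only [mem_ofPred_eq, mem_insert_iff, mem_singleton_iff]
    constructor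
    · exact (hQ n).2 c
    · rintro (rfl | rfl)
      · exact (hl.1 n).symm
      · exact hl.1 (n + 1)
  · exact (hP 0).2.2 _ (ls_bdry hG hl) (ls_straightPt hG hl) (ls_half_mem hG hl 0)

end helpers

end CCCR

open CCCR
/-- Lemma `skinny rays`: a vertex `v` and a boundary point `x`
are the initial vertex and the endpoint at infinity of a skinny ray if and only if
there are straight boundary points `y, z` with (1) `m(x,y,z) = v` and `x op_z y`,
and (2) `crt(x,y,z,w) = ⟪∗:∗:0⟫` for every straight boundary point `w ≠ x`. -/
theorem stmt17 {V : Type*} (G : SimpleGraph V) (hG : IsCCC G)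
    (hnt : Nontrivial V) (hne : NoExtremal G)
    (hnl : ¬ Nonempty (G ≃g zline)) (v : V)
    (x : Set (Set V)) (hx : IsBdryPt G x) :
    (∃ r : ℕ → V, IsSkinnyRay G r ∧ r 0 = v ∧ rayEnd G r = x) ↔
      ∃ y z : Set (Set V), IsBdryPt G y ∧ IsBdryPt G z ∧
        IsStraightPt G y ∧ IsStraightPt G z ∧
        med x y z = princ G v ∧ Op G x y z ∧
        ∀ w : Set (Set V), IsBdryPt G w → IsStraightPt G w → w ≠ x →
          ∃ a b : ℕ∞, crtEq G x y z w a b 0 := by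
  constructor
  · rintro ⟨r, hr, rfl, rfl⟩
    exact forward hG hne hr
  · rintro ⟨y, z, hy, hz, -, -, hmed, hop, hcr⟩
    exact backward hG hne v hx hy hz hmed hop hcr
end

section
/- Let X and Y be CAT(0) cube complexes with no extremal vertices, each having at least two vertices and neither isomorphic to the standard cubulation of ℝ. Then every Möbius bijection f : ∂X → ∂Y extends uniquely to a cubical isomorphism; that is, there exists a unique cubical isomorphism F : X → Y whose induced homeomorphism F̄ : X̄ → Ȳ of Roller compactifications satisfies F̄|_{∂X} = f. -/
/-!
We use the standard combinatorial model of a CAT(0) cube complex: it is identified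
with its vertex set endowed with the combinatorial (ℓ¹) metric, i.e. with a median
graph `G` on a vertex type `V`.  Halfspaces are realised as the vertex sets of the
two sides of the hyperplane dual to an edge, the Roller compactification `X̄` is the
set of ultrafilters of halfspaces, vertices embedding via principal ultrafilters,
and the Roller boundary `∂X` consists of the non-principal ultrafilters.
-/

open scoped ENNReal
open Set

open CCCR

namespace CCCRP

section median
variable {V : Type*} {G : SimpleGraph V}

theorem half_total (hG : IsCCC G) {u v : V} (huv : G.Adj u v) (w : V) :
    G.dist w v = G.dist w u + 1 ∨ G.dist w u = G.dist w v + 1 := by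
  obtain ⟨m, ⟨h1, h2, h3⟩, -⟩ := hG.2 w u v
  simp only [vInterval, mem_ofPred_eq] at h1 h2 h3
  have huv1 : G.dist u v = 1 := SimpleGraph.dist_eq_one_iff_adj.2 huv
  rw [huv1] at h2
  have hc : G.dist v u = 1 := by rw [G.dist_comm]; exact huv1
  rcases Nat.eq_zero_or_pos (G.dist u m) with h | h
  · have : u = m := hG.1.dist_eq_zero_iff.1 h
    subst this
    left
    rw [G.dist_comm (u := w) (v := v), G.dist_comm (u := w) (v := u)]
    omega
  · have h0 : G.dist m v = 0 := by omega
    have : m = v := hG.1.dist_eq_zero_iff.1 h0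
    subst this
    right
    rw [hc] at h1
    omega

theorem edge_adj_pair (hG : IsCCC G) {u v : V} (huv : G.Adj u v) {x z : V}
    (hx : G.dist x u = G.dist x v + 1) (hz : G.dist z v = G.dist z u + 1) :
    ∃ m1 m2 : V, G.dist m1 u = G.dist m1 v + 1 ∧ G.dist m2 v = G.dist m2 u + 1 ∧
      G.dist m1 m2 = 1 ∧ G.dist m1 v = G.dist m2 u ∧
      G.dist x m1 + 1 + G.dist m2 z = G.dist x z := by
  obtain ⟨m1, ⟨a1, a2, a3⟩, u1⟩ := hG.2 x z v
  obtain ⟨m2, ⟨b1, b2, b3⟩, u2⟩ := hG.2 x z u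
  obtain ⟨n, ⟨c1, c2, c3⟩, -⟩ := hG.2 m2 x v
  simp only [vInterval, mem_ofPred_eq] at *
  have T := fun a b c => hG.1.dist_triangle (u := a) (v := b) (w := c)
  have C := fun a b => G.dist_comm (u := a) (v := b)
  have t1 := half_total hG huv m2
  have t2 := half_total hG huv m1
  have hm2 : G.dist m2 v = G.dist m2 u + 1 := by
    have := T z m2 v; have := T z m2 u; omega
  have hm1 : G.dist m1 u = G.dist m1 v + 1 := by
    have := T x m1 u; have := C x m1; have := C x v; have := C m1 v; omega
  have hn : n = m1 := by
    apply u1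
    have e1 := T x n z; have e2 := T n m2 z; have e3 := T z n v; have e4 := T z m2 n
    have e5 := T z m2 v
    have := C x n; have := C x m2; have := C z n; have := C n m2; have := C m2 z
    have := C x v; have := C v n; have := C v m2; have := T z n m2; have := C n x; have := C z m2
    refine ⟨?_, ?_, ?_⟩ <;> omega
  subst hn
  have := C x n; have := C x m2; have := C z n; have := C n m2; have := C m2 z
  have := C x v; have := C v n; have := C v x; have := C u x; have := C u m2
  have := C v z; have := C u z
  refine ⟨n, m2, hm1, hm2, ?_, ?_, ?_⟩ <;> omega

theorem half_convex (hG : IsCCC G) {u v : V} (huv : G.Adj u v) {x y z : V}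
    (hx : x ∈ edgeHalf G u v) (hy : y ∈ edgeHalf G u v)
    (hz : G.dist x z + G.dist z y = G.dist x y) : z ∈ edgeHalf G u v := by
  simp only [edgeHalf, mem_ofPred_eq] at *
  by_contra hzn
  have tx := half_total hG huv x
  have ty := half_total hG huv y
  have tz := half_total hG huv z
  obtain ⟨m1, m2, p1, p2, p3, p4, p5⟩ := edge_adj_pair hG huv (x := x) (z := z) (by omega) (by omega)
  obtain ⟨n1, n2, q1, q2, q3, q4, q5⟩ := edge_adj_pair hG huv (x := y) (z := z) (by omega) (by omega)
  obtain ⟨M, ⟨a1, a2, a3⟩, -⟩ := hG.2 m1 n1 v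
  obtain ⟨N, ⟨b1, b2, b3⟩, -⟩ := hG.2 m2 n2 u
  obtain ⟨K, -, uK⟩ := hG.2 m1 n1 u
  simp only [vInterval, mem_ofPred_eq] at *
  have T := fun a b c => hG.1.dist_triangle (u := a) (v := b) (w := c)
  have C := fun a b => G.dist_comm (u := a) (v := b)
  have hM : G.dist M u = G.dist M v + 1 := by
    have := half_total hG huv M
    have := T m1 M u; have := C v M; have := C v m1; have := C M m1; omega
  have hN : G.dist N v = G.dist N u + 1 := by
    have := half_total hG huv N
    have := T m2 N v; have := C u N; have := C u m2; have := C N m2; omega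
  have h1 : M = K := by
    apply uK
    have := C u M; have := C v M; have := C v m1; have := C u m1; have := C u n1
    have := C v n1
    refine ⟨?_, ?_, ?_⟩ <;> omega
  have h2 : N = K := by
    apply uK
    have hgeo : G.dist m1 n1 = 2 + G.dist m2 n2 := by
      have := T x m1 y; have := T m1 n1 y; have := T m2 z n2; have := T m1 m2 n1
      have := T m2 n2 n1; have := C n1 y; have := C z n2; have := C n1 n2; have := C z y
      omega
    have := T m1 N n1; have := T m1 m2 N; have := T N n2 n1; have := T n1 N u; have := T n1 n2 N
    have := T m1 N u
    have := C m2 N; have := C u N; have := C N m1; have := C n1 N; have := C n2 N; have := C n1 n2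
    have := C u m1; have := C u m2; have := C u n1; have := C u n2
    refine ⟨?_, ?_, ?_⟩ <;> omega
  rw [h1] at hM; rw [h2] at hN
  omega

end median
end CCCRP

namespace CCCRP

section halves
variable {V : Type*} {G : SimpleGraph V}

theorem mem_eh {u v w : V} : w ∈ edgeHalf G u v ↔ G.dist w v < G.dist w u := Iff.rfl

theorem eh_right {u v : V} (h : G.Adj u v) : v ∈ edgeHalf G u v := by
  rw [mem_eh, SimpleGraph.dist_self, G.dist_comm, SimpleGraph.dist_eq_one_iff_adj.2 h]
  exact one_pos

theorem eh_left {u v : V} : u ∉ edgeHalf G u v := by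
  rw [mem_eh, SimpleGraph.dist_self]; omega

theorem eh_compl (hG : IsCCC G) {u v : V} (h : G.Adj u v) :
    (edgeHalf G u v)ᶜ = edgeHalf G v u := by
  ext w
  have := half_total hG h w
  rw [mem_compl_iff, mem_eh, mem_eh]
  omega

theorem eh_hs {u v : V} (h : G.Adj u v) : IsHalfspace G (edgeHalf G u v) := ⟨u, v, h, rfl⟩

theorem hs_compl (hG : IsCCC G) {h : Set V} (hh : IsHalfspace G h) : IsHalfspace G hᶜ := by
  obtain ⟨u, v, ha, rfl⟩ := hh
  exact ⟨v, u, ha.symm, eh_compl hG ha⟩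

theorem hs_nonempty {h : Set V} (hh : IsHalfspace G h) : h.Nonempty := by
  obtain ⟨u, v, ha, rfl⟩ := hh
  exact ⟨v, eh_right ha⟩

theorem hs_convex (hG : IsCCC G) {h : Set V} (hh : IsHalfspace G h) {x y z : V}
    (hx : x ∈ h) (hy : y ∈ h) (hz : G.dist x z + G.dist z y = G.dist x y) : z ∈ h := by
  obtain ⟨u, v, ha, rfl⟩ := hh
  exact half_convex hG ha hx hy hz

theorem hs_cross (hG : IsCCC G) {h : Set V} (hh : IsHalfspace G h) {a b : V} (hab : G.Adj a b)
    (ha : a ∉ h) (hb : b ∈ h) : h = edgeHalf G a b := by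
  have h1 : G.dist a b = 1 := SimpleGraph.dist_eq_one_iff_adj.2 hab
  have h2 : G.dist b a = 1 := SimpleGraph.dist_eq_one_iff_adj.2 hab.symm
  ext w
  have := half_total hG hab w
  rw [mem_eh]
  constructor
  · intro hw
    by_contra hc
    exact ha (hs_convex hG hh hw hb (by omega))
  · intro hw
    by_contra hc
    have : b ∈ hᶜ := hs_convex hG (hs_compl hG hh) (x := w) (y := a) hc ha (by omega)
    exact this hb

theorem eh_inj {p q r : V} (hq : G.Adj p q) (h : edgeHalf G p q = edgeHalf G p r)
    (hr : G.Adj p r) (hG : IsCCC G) : q = r := by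
  have : q ∈ edgeHalf G p r := h ▸ eh_right hq
  rw [mem_eh, SimpleGraph.dist_eq_one_iff_adj.2 hq.symm] at this
  exact hG.1.dist_eq_zero_iff.1 (by omega)

theorem gate (hG : IsCCC G) {h : Set V} (hh : IsHalfspace G h) {p : V} (hp : p ∉ h) :
    ∃ q, G.Adj p q ∧ h ⊆ edgeHalf G p q := by
  classical
  have hex : ∃ n, ∃ v ∈ h, G.dist p v = n := by
    obtain ⟨v, hv⟩ := hs_nonempty hh
    exact ⟨_, v, hv, rfl⟩
  obtain ⟨v, hv, hd⟩ := Nat.find_spec hex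
  have hmin : ∀ w ∈ h, G.dist p v ≤ G.dist p w := by
    intro w hw
    rw [hd]; exact Nat.find_min' hex ⟨w, hw, rfl⟩
  have hne : p ≠ v := by rintro rfl; exact hp hv
  obtain ⟨q, hpq, hq⟩ : ∃ q, G.Adj p q ∧ G.dist q v + 1 = G.dist p v := by
    obtain ⟨W, hW⟩ := hG.1.exists_walk_length_eq_dist p v
    cases W with
    | nil => exact absurd rfl hne
    | cons ha W' =>
      rename_i q
      refine ⟨q, ha, ?_⟩
      rw [SimpleGraph.Walk.length_cons] at hW
      have h1 := SimpleGraph.dist_le W'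
      have h2 := hG.1.dist_triangle (u := p) (v := q) (w := v)
      rw [SimpleGraph.dist_eq_one_iff_adj.2 ha] at h2
      omega
  refine ⟨q, hpq, fun w hw => ?_⟩
  obtain ⟨m, ⟨a1, a2, a3⟩, -⟩ := hG.2 p v w
  simp only [vInterval, mem_ofPred_eq] at a1 a2 a3
  have hm : m ∈ h := hs_convex hG hh hv hw a2
  have := hmin m hm
  have hmv : m = v := hG.1.dist_eq_zero_iff.1 (by omega)
  subst hmv
  rw [mem_eh]
  have := hG.1.dist_triangle (u := w) (v := m) (w := q)
  rw [G.dist_comm (u := m) (v := q)] at this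
  rw [G.dist_comm (u := m) (v := p)] at a3
  omega

theorem square_of_inter (hG : IsCCC G) {p a b w : V} (ha : G.Adj p a) (hb : G.Adj p b)
    (hab : a ≠ b) (h1 : w ∈ edgeHalf G p a) (h2 : w ∈ edgeHalf G p b) :
    ∃ c, c ≠ p ∧ G.Adj a c ∧ G.Adj b c := by
  have t1 := half_total hG ha w
  have t2 := half_total hG hb w
  have t3 := half_total hG ha b
  rw [mem_eh] at h1 h2
  have d1 : G.dist b p = 1 := SimpleGraph.dist_eq_one_iff_adj.2 hb.symm
  have d2 : G.dist b a ≠ 0 := fun h => hab (hG.1.dist_eq_zero_iff.1 h).symm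
  obtain ⟨m, ⟨a1, a2, a3⟩, -⟩ := hG.2 a b w
  simp only [vInterval, mem_ofPred_eq] at a1 a2 a3
  have C := fun a b => G.dist_comm (u := a) (v := b)
  have := C a b; have := C m b; have := C w a; have := C w b; have := C m w; have := C a m
  refine ⟨m, ?_, ?_, ?_⟩
  · rintro rfl; omega
  · rw [← SimpleGraph.dist_eq_one_iff_adj]; omega
  · rw [← SimpleGraph.dist_eq_one_iff_adj]; omega

theorem square_half (hG : IsCCC G) {p a b c : V} (ha : G.Adj p a) (hb : G.Adj p b)
    (hab : a ≠ b) (hcp : c ≠ p) (hac : G.Adj a c) (hbc : G.Adj b c) :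
    edgeHalf G a c = edgeHalf G p b := by
  symm
  apply hs_cross hG (eh_hs hb) hac
  · rw [mem_eh, SimpleGraph.dist_eq_one_iff_adj.2 ha.symm]
    have : G.dist a b ≠ 0 := fun h => hab (hG.1.dist_eq_zero_iff.1 h)
    omega
  · have := half_total hG hb c
    have h0 : G.dist c p ≠ 0 := fun h => hcp (hG.1.dist_eq_zero_iff.1 h)
    have h1 : G.dist c b = 1 := SimpleGraph.dist_eq_one_iff_adj.2 hbc.symm
    rw [mem_eh]; omega

theorem sep_finite (hG : IsCCC G) (p q : V) :
    {h : Set V | IsHalfspace G h ∧ p ∉ h ∧ q ∈ h}.Finite := by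
  obtain ⟨W⟩ := hG.1.preconnected p q
  induction W with
  | nil => exact (Set.finite_empty).subset (fun h hh => hh.2.1 hh.2.2)
  | @cons a b c hab W ih =>
    refine (ih.union (Set.finite_singleton (edgeHalf G a b))).subset ?_
    rintro h ⟨h1, h2, h3⟩
    by_cases hb : b ∈ h
    · right; exact hs_cross hG h1 hab h2 hb
    · left; exact ⟨h1, hb, h3⟩

/-! ultrafilters -/

theorem ultra_compl {σ : Set (Set V)} (hs : IsUltra G σ) {h : Set V} (hh : IsHalfspace G h)
    (hn : h ∉ σ) : hᶜ ∈ σ := by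
  by_contra hc
  exact hn ((hs.2.1 h hh).2 hc)

theorem ultra_not {σ : Set (Set V)} (hs : IsUltra G σ) {h k : Set V} (h1 : h ∈ σ) (h2 : k ∈ σ)
    (hd : h ⊆ kᶜ) : False := by
  obtain ⟨w, hw1, hw2⟩ := hs.2.2 h h1 k h2
  exact hd hw1 hw2

theorem ultra_up {σ : Set (Set V)} (hs : IsUltra G σ) {h k : Set V} (h1 : h ∈ σ)
    (hk : IsHalfspace G k) (hd : h ⊆ k) : k ∈ σ := by
  by_contra hc
  exact ultra_not hs h1 (ultra_compl hs hk hc) (by rwa [compl_compl])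

theorem ultra_compl_iff (hG : IsCCC G) {σ : Set (Set V)} (hs : IsUltra G σ) {p q : V}
    (h : G.Adj p q) : edgeHalf G q p ∈ σ ↔ edgeHalf G p q ∉ σ := by
  rw [← eh_compl hG h, hs.2.1 _ (eh_hs h), not_not]

/-! Gromov products -/

theorem grom_comm (v : V) (x y : Set (Set V)) : grom G v x y = grom G v y x := by
  unfold grom; congr 1; ext h; simp only [mem_ofPred_eq]; tauto

theorem grom_zero {v : V} {x y : Set (Set V)} :
    grom G v x y = 0 ↔ ∀ h ∈ x, h ∈ y → v ∈ h := by
  unfold grom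
  rw [encard_eq_zero, eq_empty_iff_forall_notMem]
  simp only [mem_ofPred_eq, not_and, not_not]

theorem grom_adj {v : V} (hG : IsCCC G) {x y : Set (Set V)} (hx : IsUltra G x) (hy : IsUltra G y)
    (h : grom G v x y ≠ 0) : ∃ q, G.Adj v q ∧ edgeHalf G v q ∈ x ∧ edgeHalf G v q ∈ y := by
  rw [Ne, grom_zero] at h
  push Not at h
  obtain ⟨k, k1, k2, k3⟩ := h
  obtain ⟨q, hq, hk⟩ := gate hG (hx.1 k k1) k3
  exact ⟨q, hq, ultra_up hx k1 (eh_hs hq) hk, ultra_up hy k2 (eh_hs hq) hk⟩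

theorem side_eq (hG : IsCCC G) {p q : V} (hpq : G.Adj p q) {h : Set V} (hh : IsHalfspace G h)
    (h1 : h ≠ edgeHalf G p q) (h2 : h ≠ edgeHalf G q p) : p ∈ h ↔ q ∈ h := by
  constructor
  · intro hp; by_contra hq; exact h2 (hs_cross hG hh hpq.symm hq hp)
  · intro hq; by_contra hp; exact h1 (hs_cross hG hh hpq hp hq)

theorem grom_step1 (hG : IsCCC G) {p q : V} (hpq : G.Adj p q) {x y : Set (Set V)}
    (hx : IsUltra G x) (hy : IsUltra G y) (h1 : edgeHalf G p q ∈ x) (h2 : edgeHalf G p q ∈ y) :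
    grom G p x y = grom G q x y + 1 := by
  unfold grom
  have : {h : Set V | h ∈ x ∧ h ∈ y ∧ p ∉ h}
      = insert (edgeHalf G p q) {h : Set V | h ∈ x ∧ h ∈ y ∧ q ∉ h} := by
    ext h
    simp only [mem_ofPred_eq, mem_insert_iff]
    constructor
    · rintro ⟨a, b, c⟩
      by_cases hq : q ∈ h
      · left; exact hs_cross hG (hx.1 h a) hpq c hq
      · right; exact ⟨a, b, hq⟩
    · rintro (rfl | ⟨a, b, c⟩)
      · exact ⟨h1, h2, eh_left⟩
      · refine ⟨a, b, fun hp => ?_⟩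
        have := hs_cross hG (hx.1 h a) hpq.symm c hp
        rw [this, ultra_compl_iff hG hx hpq] at a
        exact a h1
  rw [this, encard_insert_of_notMem]
  rintro ⟨-, -, h⟩
  exact h (eh_right hpq)

theorem grom_step2 (hG : IsCCC G) {p q : V} (hpq : G.Adj p q) {x y : Set (Set V)}
    (hx : IsUltra G x) (hy : IsUltra G y) (h1 : edgeHalf G p q ∉ x) (h2 : edgeHalf G p q ∉ y) :
    grom G q x y = grom G p x y + 1 :=
  grom_step1 hG hpq.symm hx hy ((ultra_compl_iff hG hx hpq).2 h1) ((ultra_compl_iff hG hy hpq).2 h2)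

theorem grom_step3 (hG : IsCCC G) {p q : V} (hpq : G.Adj p q) {x y : Set (Set V)}
    (hx : IsUltra G x) (hy : IsUltra G y) (h1 : edgeHalf G p q ∈ x) (h2 : edgeHalf G p q ∉ y) :
    grom G q x y = grom G p x y := by
  unfold grom
  congr 1
  ext h
  simp only [mem_ofPred_eq]
  refine and_congr_right fun a => and_congr_right fun b => not_congr (Iff.symm ?_)
  apply side_eq hG hpq (hx.1 h a)
  · rintro rfl; exact h2 b
  · rintro rfl; exact (ultra_compl_iff hG hx hpq).1 a h1

theorem grom_step4 (hG : IsCCC G) {p q : V} (hpq : G.Adj p q) {x y : Set (Set V)}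
    (hx : IsUltra G x) (hy : IsUltra G y) (h1 : edgeHalf G p q ∉ x) (h2 : edgeHalf G p q ∈ y) :
    grom G q x y = grom G p x y := by
  rw [grom_comm q, grom_comm p]; exact grom_step3 hG hpq hy hx h2 h1

/-- finiteness of the Gromov product -/
def PP (G : SimpleGraph V) (x y : Set (Set V)) : Prop := ∀ v, grom G v x y ≠ ⊤

theorem PP_comm {x y : Set (Set V)} (h : PP G x y) : PP G y x := fun v => by
  rw [grom_comm]; exact h v

theorem fin_step (hG : IsCCC G) {p q : V} (hpq : G.Adj p q) {x y : Set (Set V)}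
    (hx : IsUltra G x) (hy : IsUltra G y) (h : grom G p x y ≠ ⊤) : grom G q x y ≠ ⊤ := by
  by_cases h1 : edgeHalf G p q ∈ x <;> by_cases h2 : edgeHalf G p q ∈ y
  · rw [grom_step1 hG hpq hx hy h1 h2] at h
    intro h'; rw [h'] at h; exact h rfl
  · rwa [grom_step3 hG hpq hx hy h1 h2]
  · rwa [grom_step4 hG hpq hx hy h1 h2]
  · rw [grom_step2 hG hpq hx hy h1 h2]
    simpa using h

theorem PP_of (hG : IsCCC G) {x y : Set (Set V)} (hx : IsUltra G x) (hy : IsUltra G y) {p : V}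
    (h : grom G p x y ≠ ⊤) : PP G x y := by
  intro v
  obtain ⟨W⟩ := hG.1.preconnected p v
  induction W with
  | nil => exact h
  | cons hab W ih => exact ih (fin_step hG hab hx hy h)

theorem PP_of_zero (hG : IsCCC G) {x y : Set (Set V)} (hx : IsUltra G x) (hy : IsUltra G y) {p : V}
    (h : grom G p x y = 0) : PP G x y := PP_of hG hx hy (p := p) (by rw [h]; simp)

theorem top_of_not_PP (hG : IsCCC G) {x y : Set (Set V)} (hx : IsUltra G x) (hy : IsUltra G y)
    (h : ¬ PP G x y) (p : V) : grom G p x y = ⊤ := by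
  by_contra hc; exact h (PP_of hG hx hy hc)

theorem self_top (hG : IsCCC G) {x : Set (Set V)} (hx : IsBdryPt G x) (p : V) :
    grom G p x x = ⊤ := by
  have key : ∀ n : ℕ, ∀ p, grom G p x x ≠ n := by
    intro n
    induction n with
    | zero =>
      intro p hp
      apply hx.2 p
      have hp' := grom_zero.1 hp
      ext h
      constructor
      · intro hh; exact ⟨hx.1.1 h hh, hp' h hh hh⟩
      · rintro ⟨h1, h2⟩
        by_contra hn
        have := ultra_compl hx.1 h1 hn
        exact hp' _ this this h2
    | succ n ih =>
      intro p hp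
      obtain ⟨q, hq, h1, h2⟩ := grom_adj (v := p) hG hx.1 hx.1 (by rw [hp]; simp)
      rw [grom_step1 hG hq hx.1 hx.1 h1 h2] at hp
      push_cast at hp
      exact ih q (by simpa using hp)
  by_contra hc
  obtain ⟨n, hn⟩ := ENat.ne_top_iff_exists.1 hc
  exact key n p hn.symm

theorem bdry_adj (hG : IsCCC G) {x : Set (Set V)} (hx : IsBdryPt G x) (p : V) :
    ∃ q, G.Adj p q ∧ edgeHalf G p q ∈ x := by
  obtain ⟨q, h1, h2, -⟩ := grom_adj (v := p) hG hx.1 hx.1 (by rw [self_top hG hx]; simp)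
  exact ⟨q, h1, h2⟩

/-- centers -/
theorem center_unique (hG : IsCCC G) {x y z : Set (Set V)} (hx : IsUltra G x) (hy : IsUltra G y)
    (hz : IsUltra G z) {p q : V} (p1 : grom G p x y = 0) (p2 : grom G p y z = 0)
    (p3 : grom G p x z = 0) (q1 : grom G q x y = 0) (q2 : grom G q y z = 0)
    (q3 : grom G q x z = 0) : p = q := by
  by_contra hne
  rw [grom_zero] at *
  -- separate p and q by a halfspace
  obtain ⟨h, hh, hp, hq⟩ : ∃ h, IsHalfspace G h ∧ p ∈ h ∧ q ∉ h := by
    obtain ⟨W, hW⟩ := hG.1.exists_walk_length_eq_dist q p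
    cases W with
    | nil => exact absurd rfl hne
    | cons ha W' =>
      rename_i r
      refine ⟨_, eh_hs ha, ?_, eh_left⟩
      rw [SimpleGraph.Walk.length_cons] at hW
      have h1 := SimpleGraph.dist_le W'
      rw [mem_eh, G.dist_comm (u := p) (v := r), G.dist_comm (u := p) (v := q)]
      omega
  have hc := fun {s : Set (Set V)} (hs : IsUltra G s) => ultra_compl hs hh
  have np : ¬ p ∈ hᶜ := fun h' => h' hp
  by_cases hx1 : h ∈ x <;> by_cases hy1 : h ∈ y
  · exact hq (q1 h hx1 hy1)
  · by_cases hz1 : h ∈ z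
    · exact hq (q3 h hx1 hz1)
    · exact np (p2 _ (hc hy hy1) (hc hz hz1))
  · by_cases hz1 : h ∈ z
    · exact hq (q2 h hy1 hz1)
    · exact np (p3 _ (hc hx hx1) (hc hz hz1))
  · exact np (p1 _ (hc hx hx1) (hc hy hy1))

theorem grom_le_step (hG : IsCCC G) {p q : V} (hpq : G.Adj p q) {x y : Set (Set V)}
    (hx : IsUltra G x) (hy : IsUltra G y) (h1 : edgeHalf G p q ∈ x) :
    grom G q x y ≤ grom G p x y := by
  by_cases h2 : edgeHalf G p q ∈ y
  · rw [grom_step1 hG hpq hx hy h1 h2]; exact le_self_add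
  · rw [grom_step3 hG hpq hx hy h1 h2]

theorem center_exists (hG : IsCCC G) {x y z : Set (Set V)} (hx : IsUltra G x) (hy : IsUltra G y)
    (hz : IsUltra G z) (h1 : PP G x y) (h2 : PP G y z) (h3 : PP G x z) :
    ∃ p, grom G p x y = 0 ∧ grom G p y z = 0 ∧ grom G p x z = 0 := by
  have key : ∀ n : ℕ, ∀ p, grom G p x y + grom G p y z + grom G p x z ≤ n →
      ∃ p, grom G p x y = 0 ∧ grom G p y z = 0 ∧ grom G p x z = 0 := by
    intro n
    induction n with
    | zero =>
      intro p hp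
      refine ⟨p, ?_⟩
      simpa [and_assoc] using hp
    | succ n ih =>
      intro p hp
      by_cases c1 : grom G p x y = 0
      · by_cases c2 : grom G p y z = 0
        · by_cases c3 : grom G p x z = 0
          · exact ⟨p, c1, c2, c3⟩
          · obtain ⟨q, hq, a, b⟩ := grom_adj hG hx hz c3
            apply ih q
            have e1 := grom_step1 hG hq hx hz a b
            have e2 := grom_le_step hG hq hx hy a
            have e3 := grom_le_step hG hq hz hy b
            rw [grom_comm q z y, grom_comm p z y] at e3
            rw [e1] at hp
            have : grom G q x y + grom G q y z + grom G q x z + 1 ≤ (n + 1 : ℕ) := by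
              refine le_trans ?_ hp
              rw [add_assoc _ (grom G q x z)]
              gcongr
            push_cast at this
            exact (ENat.add_le_add_iff_right (by simp)).1 this
        · obtain ⟨q, hq, a, b⟩ := grom_adj hG hy hz c2
          apply ih q
          have e1 := grom_step1 hG hq hy hz a b
          have e2 := grom_le_step hG hq hy hx a
          have e3 := grom_le_step hG hq hz hx b
          rw [grom_comm q z x, grom_comm p z x] at e3
          rw [grom_comm q y x, grom_comm p y x] at e2
          rw [e1] at hp
          have : grom G q x y + grom G q y z + grom G q x z + 1 ≤ (n + 1 : ℕ) := by
            refine le_trans ?_ hp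
            rw [add_right_comm _ (grom G q x z), add_assoc _ (grom G q y z) 1]
            gcongr
          push_cast at this
          exact (ENat.add_le_add_iff_right (by simp)).1 this
      · obtain ⟨q, hq, a, b⟩ := grom_adj hG hx hy c1
        apply ih q
        have e1 := grom_step1 hG hq hx hy a b
        have e2 := grom_le_step hG hq hy hz b
        have e3 := grom_le_step hG hq hx hz a
        rw [e1] at hp
        have : grom G q x y + grom G q y z + grom G q x z + 1 ≤ (n + 1 : ℕ) := by
          refine le_trans ?_ hp
          rw [add_right_comm _ (grom G q x z), add_right_comm _ (grom G q y z)]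
          gcongr
        push_cast at this
        exact (ENat.add_le_add_iff_right (by simp)).1 this
  obtain ⟨p⟩ := hG.1.nonempty
  have hfin : grom G p x y + grom G p y z + grom G p x z ≠ ⊤ := by
    simp [h1 p, h2 p, h3 p]
  obtain ⟨n, hn⟩ := ENat.ne_top_iff_exists.1 hfin
  exact key n p hn.symm.le

end halves
end CCCRP

namespace CCCRP
variable {V : Type*} {G : SimpleGraph V}

/-- Straight point seen from `p`. -/
def Str (G : SimpleGraph V) (p : V) (x : Set (Set V)) : Prop :=
  IsBdryPt G x ∧ ∀ h ∈ x, ∀ k ∈ x, p ∉ h → p ∉ k → h ⊆ k ∨ k ⊆ h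

theorem opp_edge (hG : IsCCC G) (hne : NoExtremal G) {p q : V} (h : G.Adj p q) :
    ∃ r, G.Adj p r ∧ r ≠ q ∧ edgeHalf G p r ⊆ (edgeHalf G p q)ᶜ := by
  have := hne p
  unfold Extremal at this
  push Not at this
  obtain ⟨r, h1, h2, h3⟩ := this q h
  refine ⟨r, h1, h2, fun w hw hw' => h3 ?_⟩
  exact square_of_inter hG h h1 h2.symm hw' hw

theorem ray_exists (hG : IsCCC G) (hne : NoExtremal G) {p q : V} (h : G.Adj p q) :
    ∃ P : ℕ → V, P 0 = p ∧ P 1 = q ∧ (∀ n, G.Adj (P n) (P (n+1))) ∧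
      ∀ n, edgeHalf G (P (n+1)) (P (n+2)) ⊆ edgeHalf G (P n) (P (n+1)) := by
  classical
  have key : ∀ e : {e : V × V // G.Adj e.1 e.2}, ∃ e' : {e : V × V // G.Adj e.1 e.2},
      e'.1.1 = e.1.2 ∧ edgeHalf G e'.1.1 e'.1.2 ⊆ edgeHalf G e.1.1 e.1.2 := by
    rintro ⟨⟨a, b⟩, hab⟩
    obtain ⟨r, h1, h2, h3⟩ := opp_edge hG hne (show G.Adj b a from hab.symm)
    refine ⟨⟨(b, r), h1⟩, rfl, ?_⟩
    rw [eh_compl hG hab.symm] at h3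
    exact h3
  choose T hT1 hT2 using key
  let S : ℕ → {e : V × V // G.Adj e.1 e.2} := fun n => T^[n] ⟨(p, q), h⟩
  have hS : ∀ n, S (n+1) = T (S n) := fun n => Function.iterate_succ_apply' T n _
  have e1 : ∀ n, (S (n+1)).1.1 = (S n).1.2 := fun n => by rw [hS]; exact hT1 _
  refine ⟨fun n => (S n).1.1, rfl, e1 0, fun n => ?_, fun n => ?_⟩
  · show G.Adj (S n).1.1 (S (n+1)).1.1
    rw [e1]; exact (S n).2
  · show edgeHalf G (S (n+1)).1.1 (S (n+1+1)).1.1 ⊆ edgeHalf G (S n).1.1 (S (n+1)).1.1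
    rw [e1 (n+1), e1 n]
    have := hT2 (S n)
    rw [← hS, e1] at this
    exact this

theorem E_lemma (hG : IsCCC G) (hne : NoExtremal G) {p q : V} (hpq : G.Adj p q) :
    ∃ x, Str G p x ∧ edgeHalf G p q ∈ x ∧ ∀ h ∈ x, p ∉ h → h ⊆ edgeHalf G p q := by
  obtain ⟨P, hP0, hP1, hadj, hnest⟩ := ray_exists hG hne hpq
  have anti : Antitone fun n => edgeHalf G (P n) (P (n+1)) := antitone_nat_of_succ_le hnest
  have later : ∀ m k, m < k → P k ∈ edgeHalf G (P m) (P (m+1)) := by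
    intro m k hk
    obtain ⟨j, rfl⟩ : ∃ j, k = j + 1 := ⟨k - 1, by omega⟩
    exact anti (show m ≤ j by omega) (eh_right (hadj j))
  have cross : ∀ h, IsHalfspace G h → ∀ n, P n ∉ h → P (n+1) ∈ h →
      h = edgeHalf G (P n) (P (n+1)) := fun h hh n h1 h2 => hs_cross hG hh (hadj n) h1 h2
  have hmem : ∀ n, edgeHalf G (P n) (P (n+1)) ∈ rayEnd G P := fun n =>
    ⟨eh_hs (hadj n), n+1, fun k hk => later n k hk⟩
  have evt : ∀ h, IsHalfspace G h → h ∉ rayEnd G P → hᶜ ∈ rayEnd G P := by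
    intro h hh hn
    refine ⟨hs_compl hG hh, ?_⟩
    by_contra hc
    apply hn
    have hc' : ∀ N, ∃ n, N ≤ n ∧ P n ∈ h := by
      intro N; by_contra hx; push Not at hx; exact hc ⟨N, fun n hn => hx n hn⟩
    refine ⟨hh, ?_⟩
    by_cases hup : ∃ n, P n ∉ h ∧ P (n+1) ∈ h
    · obtain ⟨n, h1, h2⟩ := hup
      rw [cross h hh n h1 h2]; exact ⟨n+1, fun k hk => later n k hk⟩
    · push Not at hup
      obtain ⟨a, -, ha⟩ := hc' 0
      refine ⟨a, fun n hn => ?_⟩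
      by_contra hx
      have stay : ∀ k, P (n + k) ∉ h := by
        intro k; induction k with
        | zero => exact hx
        | succ k ih => exact hup _ ih
      obtain ⟨m, hm1, hm2⟩ := hc' n
      obtain ⟨k, rfl⟩ := Nat.exists_eq_add_of_le hm1
      exact stay k hm2
  have inter : ∀ h ∈ rayEnd G P, ∀ k ∈ rayEnd G P, (h ∩ k).Nonempty := by
    rintro h ⟨-, N, hN⟩ k ⟨-, M, hM⟩
    exact ⟨P (max N M), hN _ (le_max_left _ _), hM _ (le_max_right _ _)⟩
  have desc : ∀ h ∈ rayEnd G P, p ∉ h → ∃ n, h = edgeHalf G (P n) (P (n+1)) := by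
    classical
    rintro h ⟨hh, N, hN⟩ hp
    have hex : ∃ n, P n ∈ h := ⟨N, hN N le_rfl⟩
    have h0 : Nat.find hex ≠ 0 := by
      intro h0; have := Nat.find_spec hex; rw [h0, hP0] at this; exact hp this
    obtain ⟨j, hj⟩ := Nat.exists_eq_succ_of_ne_zero h0
    refine ⟨j, cross h hh j (Nat.find_min hex (by omega)) ?_⟩
    have := Nat.find_spec hex; rw [hj] at this; exact this
  refine ⟨rayEnd G P, ⟨⟨⟨fun h hh => hh.1, fun h hh => ⟨fun h1 h2 => ?_, fun h1 => ?_⟩, inter⟩, ?_⟩,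
    ?_⟩, ?_, ?_⟩
  · obtain ⟨w, hw1, hw2⟩ := inter _ h1 _ h2
    exact hw2 hw1
  · by_contra h2; exact h1 (evt h hh h2)
  · intro v hv
    have : ∀ n, G.dist v (P (n+1)) < G.dist v (P n) := by
      intro n
      have := hmem n
      rw [hv] at this
      exact this.2
    have h2 : ∀ n, G.dist v (P n) + n ≤ G.dist v (P 0) := by
      intro n; induction n with
      | zero => simp
      | succ n ih => have := this n; omega
    have := h2 (G.dist v (P 0) + 1)
    omega
  · intro h hh k hk h1 h2
    obtain ⟨n, rfl⟩ := desc h hh h1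
    obtain ⟨m, rfl⟩ := desc k hk h2
    rcases le_total n m with h | h
    · exact Or.inr (anti h)
    · exact Or.inl (anti h)
  · have := hmem 0
    rwa [hP0, hP1] at this
  · intro h hh hp
    obtain ⟨n, rfl⟩ := desc h hh hp
    have := anti (Nat.zero_le n)
    simpa [hP0, hP1] using this

theorem O_lemma (hG : IsCCC G) (hne : NoExtremal G) {p q : V} (hpq : G.Adj p q) :
    ∃ y, Str G p y ∧ (∀ h ∈ y, p ∉ h → h ⊆ (edgeHalf G p q)ᶜ) ∧ edgeHalf G p q ∉ y := by
  obtain ⟨r, h1, h2, h3⟩ := opp_edge hG hne hpq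
  obtain ⟨y, hy, hy1, hy2⟩ := E_lemma hG hne h1
  have := fun h hh hp => (hy2 h hh hp).trans h3
  refine ⟨y, hy, this, fun hc => ?_⟩
  exact ultra_not hy.1.1 hc hc (this _ hc eh_left)

theorem C_lemma (hG : IsCCC G) {p : V} {x u : Set (Set V)} (hx : Str G p x) (hu : IsUltra G u)
    (ht : grom G p x u = ⊤) : ∀ h ∈ x, p ∉ h → h ∈ u := by
  intro h hh hp
  obtain ⟨q, hq⟩ := hs_nonempty (hx.1.1.1 h hh)
  by_contra hc
  have : {k | k ∈ x ∧ k ∈ u ∧ p ∉ k} ⊆ {k | IsHalfspace G k ∧ p ∉ k ∧ q ∈ k} := by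
    rintro k ⟨k1, k2, k3⟩
    refine ⟨hu.1 k k2, k3, ?_⟩
    rcases hx.2 h hh k k1 hp k3 with h' | h'
    · exact h' hq
    · exact absurd (ultra_up hu k2 (hx.1.1.1 h hh) h') hc
  have hf := (sep_finite hG p q).subset this
  have : grom G p x u ≠ ⊤ := by
    unfold grom; exact encard_ne_top_iff.mpr hf
  exact this ht

theorem Str_move (hG : IsCCC G) {p q : V} {x : Set (Set V)} (hpq : G.Adj p q) (hx : Str G p x)
    (h : edgeHalf G p q ∈ x) : Str G q x := by
  have : ∀ k ∈ x, q ∉ k → p ∉ k := by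
    intro k hk hq hp
    have := hs_cross hG (hx.1.1.1 k hk) hpq.symm hq hp
    have h2 := (ultra_compl_iff hG hx.1.1 hpq).1 (this ▸ hk)
    exact h2 h
  exact ⟨hx.1, fun a ha b hb h1 h2 => hx.2 a ha b hb (this a ha h1) (this b hb h2)⟩

/-- adjacent halfspace of a straight point is unique -/
theorem Str_adj_unique (hG : IsCCC G) {p q r : V} {x : Set (Set V)} (hx : Str G p x)
    (hq : G.Adj p q) (hr : G.Adj p r)
    (h1 : edgeHalf G p q ∈ x) (h2 : edgeHalf G p r ∈ x) : q = r := by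
  rcases hx.2 _ h1 _ h2 eh_left eh_left with h | h
  · have := hs_cross hG (eh_hs hr) hq eh_left (h (eh_right hq))
    exact (eh_inj hr this hq hG).symm
  · have := hs_cross hG (eh_hs hq) hr eh_left (h (eh_right hr))
    exact eh_inj hq this hr hG

/-- straight line through an edge -/
theorem grom_zero_of (hG : IsCCC G) {p q : V} {x y : Set (Set V)} (hpq : G.Adj p q)
    (hx : IsUltra G x) (hy : ∀ h ∈ y, p ∉ h → h ⊆ (edgeHalf G p q)ᶜ)
    (h : edgeHalf G p q ∈ x) : grom G p y x = 0 := by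
  rw [grom_zero]
  intro k hk hk2
  by_contra hc
  exact ultra_not hx hk2 h (hy k hk hc)

theorem grom_E (hG : IsCCC G) {p q : V} {x u : Set (Set V)} (hpq : G.Adj p q)
    (hu : IsUltra G u) (hx1 : edgeHalf G p q ∈ x)
    (hx : ∀ h ∈ x, p ∉ h → h ⊆ edgeHalf G p q) : grom G p x u ≠ 0 ↔ edgeHalf G p q ∈ u := by
  rw [Ne, grom_zero]
  constructor
  · intro h
    push Not at h
    obtain ⟨k, h1, h2, h3⟩ := h
    exact ultra_up hu h2 (eh_hs hpq) (hx k h1 h3)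
  · intro h hc
    exact eh_left (hc _ hx1 h)

theorem ultra_ext {x y : Set (Set V)} (hx : IsUltra G x) (hy : IsUltra G y)
    (h : ∀ k ∈ y, k ∈ x) : x = y := by
  refine Subset.antisymm (fun k hk => ?_) h
  by_contra hc
  have := h _ (ultra_compl hy (hx.1 k hk) hc)
  exact ultra_not hx hk this (by simp)

end CCCRP

namespace CCCRP
variable {V V' : Type*} {G : SimpleGraph V} {G' : SimpleGraph V'}

/-- `f` preserves finiteness of Gromov products -/
def PPpres (G : SimpleGraph V) (G' : SimpleGraph V') (f : Bdry G → Bdry G') : Prop :=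
  ∀ x y : Bdry G, PP G x.1 y.1 → PP G' (f x).1 (f y).1

/-- cross ratio equality in additive form -/
def Qpres (G : SimpleGraph V) (G' : SimpleGraph V') (f : Bdry G → Bdry G') : Prop :=
  ∀ x y z w : Bdry G, PP G x.1 z.1 → PP G y.1 w.1 → PP G x.1 w.1 → PP G y.1 z.1 →
    ∀ v v', grom G v x.1 z.1 + grom G v y.1 w.1 +
        (grom G' v' (f x).1 (f w).1 + grom G' v' (f y).1 (f z).1) =
      grom G' v' (f x).1 (f z).1 + grom G' v' (f y).1 (f w).1 +
        (grom G v x.1 w.1 + grom G v y.1 z.1)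

/-- infinite Gromov products are kept in the presence of two auxiliary points -/
def Rpres (G : SimpleGraph V) (G' : SimpleGraph V') (f : Bdry G → Bdry G') : Prop :=
  ∀ x y z t : Bdry G, PP G x.1 z.1 → PP G y.1 z.1 → PP G x.1 t.1 → PP G y.1 t.1 →
    PP G z.1 t.1 → PP G' (f x).1 (f y).1 → PP G x.1 y.1

theorem mob_pp {f : Bdry G → Bdry G'} (hG' : IsCCC G') (hm : Mobius G G' f) : PPpres G G' f := by
  intro x y hxy v'
  have hA : memA G x.1 x.1 y.1 y.1 := by
    intro v
    refine Or.inr (Or.inr ⟨?_, ?_⟩) <;> simp [tripod, hxy v]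
  have := (hm x x y y hA).1 v'
  unfold inA at this
  simp only [tripod, self_top hG' (f x).2] at this
  intro hc
  simp [hc] at this

theorem toE_nat (n : ℕ) : toE (n : ℕ∞) = ((n : ℝ) : EReal) := by
  unfold toE
  simp only [ENat.toENNReal_coe]
  rw [← ENNReal.ofReal_natCast, EReal.coe_ennreal_ofReal, max_eq_left (Nat.cast_nonneg n)]

theorem mob_q {f : Bdry G → Bdry G'} (hG' : IsCCC G') (hm : Mobius G G' f) : Qpres G G' f := by
  intro x y z w h1 h2 h3 h4 v v'
  have hpp := mob_pp hG' hm
  have hA : memA G x.1 y.1 z.1 w.1 := by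
    intro v
    refine Or.inr (Or.inr ⟨?_, ?_⟩) <;> simp [tripod, h1 v, h2 v, h3 v, h4 v]
  have hc := (hm x y z w hA).2 v v'
  unfold crv at hc
  have k1 := hpp _ _ h1 v'
  have k2 := hpp _ _ h2 v'
  have k3 := hpp _ _ h3 v'
  have k4 := hpp _ _ h4 v'
  have h1 := h1 v
  have h2 := h2 v
  have h3 := h3 v
  have h4 := h4 v
  generalize grom G v x.1 z.1 = a1 at *
  generalize grom G v y.1 w.1 = a2 at *
  generalize grom G v x.1 w.1 = a3 at *
  generalize grom G v y.1 z.1 = a4 at *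
  generalize grom G' v' (f x).1 (f z).1 = b1 at *
  generalize grom G' v' (f y).1 (f w).1 = b2 at *
  generalize grom G' v' (f x).1 (f w).1 = b3 at *
  generalize grom G' v' (f y).1 (f z).1 = b4 at *
  lift a1 to ℕ using h1
  lift a2 to ℕ using h2
  lift a3 to ℕ using h3
  lift a4 to ℕ using h4
  lift b1 to ℕ using k1
  lift b2 to ℕ using k2
  lift b3 to ℕ using k3
  lift b4 to ℕ using k4
  simp only [toE_nat] at hc
  simp only [← EReal.coe_add, ← EReal.coe_sub, EReal.coe_eq_coe_iff] at hc
  have : ((a1 : ℝ) + a2 + (b3 + b4)) = b1 + b2 + (a3 + a4) := by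
    linarith
  norm_cast at this ⊢

theorem mob_r {f : Bdry G → Bdry G'} (hG : IsCCC G) (hG' : IsCCC G') (hm : Mobius G G' f) :
    Rpres G G' f := by
  intro x y z t h1 h2 h3 h4 h5 h6
  by_contra hn
  have hpp := mob_pp hG' hm
  have ht := top_of_not_PP hG x.2.1 y.2.1 hn
  obtain ⟨v⟩ := hG.1.nonempty
  obtain ⟨v'⟩ := hG'.1.nonempty
  have hA : memA G x.1 z.1 y.1 t.1 := by
    intro v
    refine Or.inr (Or.inl ⟨?_, ?_⟩)
    · simp [tripod, h1 v, h4 v]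
    · simp [tripod, h3 v, PP_comm h2 v]
  have hc := (hm x z y t hA).2 v v'
  unfold crv at hc
  rw [ht v] at hc
  have k1 := hpp _ _ h5 v'
  have k2 := hpp _ _ (PP_comm h2) v'
  have k3 := hpp _ _ h3 v'
  have k4 := h6 v'
  have h1 := h5 v
  have h2 := PP_comm h2 v
  have h3 := h3 v
  generalize grom G v z.1 t.1 = a1 at *
  generalize grom G v z.1 y.1 = a2 at *
  generalize grom G v x.1 t.1 = a3 at *
  generalize grom G' v' (f z).1 (f t).1 = b1 at *
  generalize grom G' v' (f z).1 (f y).1 = b2 at *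
  generalize grom G' v' (f x).1 (f t).1 = b3 at *
  generalize grom G' v' (f x).1 (f y).1 = b4 at *
  lift a1 to ℕ using h1
  lift a2 to ℕ using h2
  lift a3 to ℕ using h3
  lift b1 to ℕ using k1
  lift b2 to ℕ using k2
  lift b3 to ℕ using k3
  lift b4 to ℕ using k4
  have e : toE ⊤ = (⊤ : EReal) := by simp [toE]
  simp only [toE_nat, e] at hc
  rw [EReal.top_add_coe, EReal.top_sub_coe, EReal.top_sub_coe] at hc
  simp only [← EReal.coe_add, ← EReal.coe_sub] at hc
  exact EReal.coe_ne_top _ hc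

end CCCRP

namespace CCCRP
variable {V V' : Type*} {G : SimpleGraph V} {G' : SimpleGraph V'}

theorem SQ (hG : IsCCC G) (hne : NoExtremal G) {p a b c : V} (ha : G.Adj p a) (hb : G.Adj p b)
    (hab : a ≠ b) (hcp : c ≠ p) (hac : G.Adj a c) (hbc : G.Adj b c) :
    ∃ t, Str G a t ∧ (∀ h ∈ t, a ∉ h → h ⊆ (edgeHalf G p b)ᶜ) ∧ edgeHalf G p b ∉ t ∧
      edgeHalf G p a ∈ t ∧ ∀ u, IsUltra G u → edgeHalf G p b ∈ u → grom G a t u = 0 := by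
  have e1 := square_half hG ha hb hab hcp hac hbc
  have e2 := square_half hG hb ha hab.symm hcp hbc hac
  obtain ⟨t, h1, h2, h3⟩ := O_lemma hG hne hac
  rw [e1] at h2 h3
  refine ⟨t, h1, h2, h3, ?_, fun u hu hbu => ?_⟩
  · by_contra hc
    have h4 := (ultra_compl_iff hG h1.1.1 ha).2 hc
    have h5 := h2 _ h4 eh_left
    have h6 : b ∈ edgeHalf G a p := by
      rw [← eh_compl hG ha, ← e2]; exact eh_left
    exact h5 h6 (eh_right hb)
  · refine grom_zero_of hG hac hu ?_ ?_
    · rw [e1]; exact h2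
    · rw [e1]; exact hbu

theorem claim2 {f : Bdry G → Bdry G'} (hG : IsCCC G) (hne : NoExtremal G) (hG' : IsCCC G')
    (hR : Rpres G G' f) {x y : Bdry G} {p0 : V} (hx : Str G p0 x.1)
    (hf : PP G' (f x).1 (f y).1) : PP G x.1 y.1 := by
  by_contra hn
  have htop := top_of_not_PP hG x.2.1 y.2.1 hn
  by_cases hxy : x = y
  · subst hxy
    obtain ⟨v'⟩ := hG'.1.nonempty
    exact hf v' (self_top hG' (f x).2 v')
  obtain ⟨k, hky, hkx⟩ : ∃ k ∈ y.1, k ∉ x.1 := by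
    by_contra hc
    push Not at hc
    exact hxy (Subtype.ext (ultra_ext x.2.1 y.2.1 hc))
  have hk := y.2.1.1 k hky
  obtain ⟨q0, hq0⟩ := hs_nonempty hk
  have main : ∀ n, ∀ p, G.dist q0 p = n → Str G p x.1 →
      ∃ p b, Str G p x.1 ∧ G.Adj p b ∧ edgeHalf G p b ∈ y.1 ∧ edgeHalf G p b ∉ x.1 := by
    intro n
    induction n using Nat.strong_induction_on with
    | _ n ih =>
      intro p hp hxp
      have hpk : p ∉ k := by
        intro hpk
        have h1 := ultra_compl x.2.1 hk hkx
        have h2 := C_lemma hG hxp y.2.1 (htop p) _ h1 (by simpa using hpk)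
        exact ultra_not y.2.1 hky h2 (by simp)
      obtain ⟨b, hb, hkb⟩ := gate hG hk hpk
      by_cases hbx : edgeHalf G p b ∈ x.1
      · exact ih (G.dist q0 b) (by have := hkb hq0; rw [mem_eh] at this; omega) b rfl
          (Str_move hG hb hxp hbx)
      · exact ⟨p, b, hxp, hb, ultra_up y.2.1 hky (eh_hs hb) hkb, hbx⟩
  obtain ⟨p, b, hxp, hb, hby, hbx⟩ := main _ p0 rfl hx
  obtain ⟨p1, hp1, h0x, h0y⟩ := grom_adj hG x.2.1 y.2.1 (v := p) (by rw [htop]; simp)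
  have hne1 : p1 ≠ b := by rintro rfl; exact hbx h0x
  obtain ⟨w0, hw1, hw2⟩ := y.2.1.2.2 _ h0y _ hby
  obtain ⟨w, hwp, hw3, hw4⟩ := square_of_inter hG hp1 hb hne1 hw1 hw2
  obtain ⟨t, t1, t2, t3, t4, t5⟩ := SQ hG hne hp1 hb hne1 hwp hw3 hw4
  have ty := t5 _ y.2.1 hby
  have hxp1 := Str_move hG hp1 hxp h0x
  have tx : PP G x.1 t := by
    by_contra hc
    have h2 := C_lemma hG hxp1 t1.1.1 (top_of_not_PP hG x.2.1 t1.1.1 hc p1)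
    have h3 := C_lemma hG hxp1 y.2.1 (htop p1)
    obtain ⟨q1, hq1, hq2⟩ := bdry_adj hG x.2 p1
    exact eh_left (grom_zero.1 ty _ (h2 _ hq2 eh_left) (h3 _ hq2 eh_left))
  obtain ⟨z, z1, z2, z3⟩ := O_lemma hG hne hp1
  refine hn (hR x y ⟨z, z1.1⟩ ⟨t, t1.1⟩ ?_ ?_ tx ?_ ?_ hf)
  · exact PP_comm (PP_of_zero hG z1.1.1 x.2.1 (grom_zero_of hG hp1 x.2.1 z2 h0x))
  · exact PP_comm (PP_of_zero hG z1.1.1 y.2.1 (grom_zero_of hG hp1 y.2.1 z2 h0y))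
  · exact PP_comm (PP_of_zero hG t1.1.1 y.2.1 ty)
  · exact (PP_of_zero hG z1.1.1 t1.1.1 (grom_zero_of hG hp1 t1.1.1 z2 t4))

/-- `p'` matches `p` -/
def M (G : SimpleGraph V) (G' : SimpleGraph V') (f : Bdry G → Bdry G') (p : V) (p' : V') : Prop :=
  ∀ w w' : Bdry G, PP G w.1 w'.1 → grom G p w.1 w'.1 = grom G' p' (f w).1 (f w').1

theorem edge_lemma {f : Bdry G ≃ Bdry G'} (hG : IsCCC G) (hne : NoExtremal G) (hG' : IsCCC G')
    (hne' : NoExtremal G') (hR : Rpres G G' f)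
    (hS : ∀ x y : Bdry G, ∀ p, Str G p x.1 → PP G' (f x).1 (f y).1 → PP G x.1 y.1)
    {p q : V} {p' : V'} (hM : M G G' f p p') (hpq : G.Adj p q) :
    ∃ q', G'.Adj p' q' ∧ ∀ u : Bdry G, edgeHalf G p q ∈ u.1 ↔ edgeHalf G' p' q' ∈ (f u).1 := by
  obtain ⟨x0, sx, hx1, hx2⟩ := E_lemma hG hne hpq
  obtain ⟨y0, sy, hy1, hy2⟩ := O_lemma hG hne hpq
  let x : Bdry G := ⟨x0, sx.1⟩
  let y : Bdry G := ⟨y0, sy.1⟩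
  have eqv : ∀ u : Bdry G, edgeHalf G p q ∈ u.1 ↔ grom G' p' (f x).1 (f u).1 ≠ 0 := by
    intro u
    rw [← grom_E hG hpq u.2.1 hx1 hx2]
    by_cases h : PP G x.1 u.1
    · rw [← hM x u h]
    · rw [top_of_not_PP hG' (f x).2.1 (f u).2.1 (fun h' => h (hS x u p sx h')) p',
        top_of_not_PP hG sx.1.1 u.2.1 h p]
  have uniq : ∀ v1 v2, G'.Adj p' v1 → G'.Adj p' v2 → edgeHalf G' p' v1 ∈ (f x).1 →
      edgeHalf G' p' v2 ∈ (f x).1 → v1 = v2 := by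
    intro v1 v2 hv1 hv2 h1 h2
    by_contra hv
    obtain ⟨w0, hw1, hw2⟩ := (f x).2.1.2.2 _ h1 _ h2
    obtain ⟨v3, c1, c2, c3⟩ := square_of_inter hG' hv1 hv2 hv hw1 hw2
    obtain ⟨w1, a1, a2, a3, a4, a5⟩ := SQ hG' hne' hv1 hv2 hv c1 c2 c3
    obtain ⟨w2, b1, b2, b3, b4, b5⟩ := SQ hG' hne' hv2 hv1 (Ne.symm hv) c1 c3 c2
    obtain ⟨u1, hu1⟩ := f.surjective ⟨w1, a1.1⟩
    obtain ⟨u2, hu2⟩ := f.surjective ⟨w2, b1.1⟩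
    have f1 : (f u1).1 = w1 := by rw [hu1]
    have f2 : (f u2).1 = w2 := by rw [hu2]
    have m1 : edgeHalf G p q ∈ u1.1 := by
      rw [eqv, f1, Ne, grom_zero]
      exact fun hc => eh_left (hc _ h1 a4)
    have m2 : edgeHalf G p q ∈ u2.1 := by
      rw [eqv, f2, Ne, grom_zero]
      exact fun hc => eh_left (hc _ h2 b4)
    have p1 : PP G x.1 u1.1 := hS x u1 p sx (by
      rw [f1]; exact PP_comm (PP_of_zero hG' a1.1.1 (f x).2.1 (a5 _ (f x).2.1 h2)))
    have p2 : PP G x.1 u2.1 := hS x u2 p sx (by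
      rw [f2]; exact PP_comm (PP_of_zero hG' b1.1.1 (f x).2.1 (b5 _ (f x).2.1 h1)))
    have yz : ∀ u, IsUltra G u → edgeHalf G p q ∈ u → PP G u y.1 := fun u hu h =>
      PP_comm (PP_of_zero hG sy.1.1 hu (grom_zero_of hG hpq hu hy1 h))
    have hz : grom G' p' (f u1).1 (f u2).1 = 0 := by
      rw [f1, f2, grom_zero]
      intro k k1 k2
      by_contra hpk
      by_cases hvk : v1 ∈ k
      · have := hs_cross hG' (a1.1.1.1 k k1) hv1 hpk hvk
        rw [this] at k2
        exact b3 k2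
      · exact ultra_not b1.1.1 k2 b4 (a2 k k1 hvk)
    have pu := hR u1 u2 x y (PP_comm p1) (PP_comm p2) (yz _ u1.2.1 m1) (yz _ u2.2.1 m2)
      (yz _ sx.1.1 hx1) (PP_of_zero hG' (f u1).2.1 (f u2).2.1 hz)
    have := hM u1 u2 pu
    rw [hz, grom_zero] at this
    exact eh_left (this _ m1 m2)
  obtain ⟨q', hq', hq2⟩ := bdry_adj hG' (f x).2 p'
  refine ⟨q', hq', fun u => ?_⟩
  rw [eqv]
  constructor
  · intro h
    obtain ⟨r, r1, r2, r3⟩ := grom_adj hG' (f x).2.1 (f u).2.1 h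
    rw [uniq q' r hq' r1 hq2 r2]; exact r3
  · intro h hc
    exact eh_left (grom_zero.1 hc _ hq2 h)

theorem match_unique {f : Bdry G ≃ Bdry G'} (hG' : IsCCC G') (hne' : NoExtremal G')
    {p' q' r' : V'} (hq : G'.Adj p' q') (hr : G'.Adj p' r')
    (h : ∀ u : Bdry G, edgeHalf G' p' q' ∈ (f u).1 ↔ edgeHalf G' p' r' ∈ (f u).1) : q' = r' := by
  obtain ⟨x, sx, h1, h2⟩ := E_lemma hG' hne' hq
  obtain ⟨u, hu⟩ := f.surjective ⟨x, sx.1⟩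
  have := h u
  rw [hu] at this
  exact Str_adj_unique hG' sx hq hr h1 (this.1 h1)

theorem match_M {f : Bdry G → Bdry G'} (hG : IsCCC G) (hG' : IsCCC G') (hpp : PPpres G G' f)
    {p q : V} {p' q' : V'} (hM : M G G' f p p') (hpq : G.Adj p q) (hpq' : G'.Adj p' q')
    (h : ∀ u : Bdry G, edgeHalf G p q ∈ u.1 ↔ edgeHalf G' p' q' ∈ (f u).1) : M G G' f q q' := by
  intro w w' hw
  have h0 := hM w w' hw
  by_cases h1 : edgeHalf G p q ∈ w.1 <;> by_cases h2 : edgeHalf G p q ∈ w'.1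
  · rw [grom_step1 hG hpq w.2.1 w'.2.1 h1 h2,
      grom_step1 hG' hpq' (f w).2.1 (f w').2.1 ((h w).1 h1) ((h w').1 h2)] at h0
    exact ENat.add_left_injective_of_ne_top (n := 1) (by simp) h0
  · rw [grom_step3 hG hpq w.2.1 w'.2.1 h1 h2,
      grom_step3 hG' hpq' (f w).2.1 (f w').2.1 ((h w).1 h1) (by rwa [← h w']), h0]
  · rw [grom_step4 hG hpq w.2.1 w'.2.1 h1 h2,
      grom_step4 hG' hpq' (f w).2.1 (f w').2.1 (by rwa [← h w]) ((h w').1 h2), h0]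
  · rw [grom_step2 hG hpq w.2.1 w'.2.1 h1 h2,
      grom_step2 hG' hpq' (f w).2.1 (f w').2.1 (by rwa [← h w]) (by rwa [← h w']), h0]

end CCCRP

namespace CCCRP
variable {V V' : Type*} {G : SimpleGraph V} {G' : SimpleGraph V'}

/-- vertices of a bi-infinite line glued from two rays -/
def glue (P Q : ℕ → V) : ℤ → V
  | Int.ofNat n => P n
  | Int.negSucc n => Q (n + 2)

theorem line_exists (hG : IsCCC G) (hne : NoExtremal G) {p q : V} (h : G.Adj p q) :
    ∃ L : ℤ → V, (∀ n, G.Adj (L n) (L (n+1))) ∧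
      ∀ n, edgeHalf G (L (n+1)) (L (n+1+1)) ⊆ edgeHalf G (L n) (L (n+1)) := by
  obtain ⟨P, P0, P1, Pa, Pn⟩ := ray_exists hG hne h
  obtain ⟨Q, Q0, Q1, Qa, Qn⟩ := ray_exists hG hne h.symm
  have gp : ∀ n : ℕ, glue P Q (n : ℤ) = P n := fun n => rfl
  have gq : ∀ n : ℕ, glue P Q (-(n : ℤ)) = Q (n + 1) := by
    intro n
    cases n with
    | zero => simp [Q1, ← P0]; exact gp 0
    | succ n => rfl
  have comp : ∀ k, (edgeHalf G (Q k) (Q (k+1)))ᶜ = edgeHalf G (Q (k+1)) (Q k) :=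
    fun k => eh_compl hG (Qa k)
  have gq' : ∀ k : ℕ, glue P Q (-(k : ℤ) + 1) = Q k := by
    intro k
    cases k with
    | zero => have := gp 1; simp at this; simp [this, P1, Q0]
    | succ k => rw [show (-((k+1 : ℕ) : ℤ) + 1) = -(k : ℤ) by push_cast; ring]; exact gq k
  have dich : ∀ n : ℤ, (∃ k : ℕ, n = k) ∨ (∃ k : ℕ, n = -((k + 1 : ℕ) : ℤ)) := by
    intro n
    rcases n with k | k
    · exact Or.inl ⟨k, rfl⟩
    · exact Or.inr ⟨k, rfl⟩
  refine ⟨glue P Q, fun n => ?_, fun n => ?_⟩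
  · rcases dich n with ⟨k, rfl⟩ | ⟨k, rfl⟩
    · have := gp (k+1)
      push_cast at this
      rw [this, gp]; exact Pa k
    · rw [gq', gq]; exact (Qa _).symm
  · rcases dich n with ⟨k, rfl⟩ | ⟨k, rfl⟩
    · have h1 := gp (k+1)
      have h2 := gp (k+1+1)
      push_cast at h1 h2
      rw [h1, h2, gp]; exact Pn k
    · have e : (-((k+1 : ℕ) : ℤ) + 1) = -(k : ℤ) := by push_cast; ring
      have h2 : glue P Q (-((k+1 : ℕ) : ℤ) + 1) = Q (k + 1) := gq' _
      have h3 : glue P Q (-((k+1 : ℕ) : ℤ) + 1 + 1) = Q k := by rw [e]; exact gq' k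
      rw [h2, h3, gq, ← comp, ← comp]
      exact compl_subset_compl.2 (Qn k)

theorem branch3 (hG : IsCCC G) (hne : NoExtremal G) (hnt : Nontrivial V)
    (hnl : ¬ Nonempty (G ≃g zline)) :
    ∃ p a b c : V, G.Adj p a ∧ G.Adj p b ∧ G.Adj p c ∧ a ≠ b ∧ a ≠ c ∧ b ≠ c := by
  by_contra hno
  push Not at hno
  apply hnl
  obtain ⟨p, q, hpq⟩ : ∃ p q, G.Adj p q := by
    obtain ⟨p⟩ := hG.1.nonempty
    haveI := hG.1
    obtain ⟨q, hq⟩ := hG.1.preconnected.exists_adj_of_nontrivial p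
    exact ⟨p, q, hq⟩
  obtain ⟨L, La, Ln⟩ := line_exists hG hne hpq
  have anti : Antitone fun n => edgeHalf G (L n) (L (n+1)) := antitone_int_of_succ_le Ln
  have lt_ne : ∀ m n, m < n → L m ≠ L n := by
    intro m n hmn he
    have h1 : L (n - 1 + 1) ∈ edgeHalf G (L (n-1)) (L (n - 1 + 1)) := eh_right (La (n-1))
    have h2 := anti (show m ≤ n - 1 by omega) h1
    rw [sub_add_cancel, ← he] at h2
    exact eh_left h2
  have inj : Function.Injective L := by
    intro m n h
    rcases lt_trichotomy m n with h' | h' | h'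
    · exact absurd h (lt_ne _ _ h')
    · exact h'
    · exact absurd h.symm (lt_ne _ _ h')
  have nb : ∀ n w, G.Adj (L n) w → w = L (n+1) ∨ w = L (n-1) := by
    intro n w hw
    have h1 := La n
    have h2 := La (n-1)
    rw [sub_add_cancel] at h2
    by_contra hc
    push Not at hc
    exact hc.2 (hno (L n) (L (n+1)) w (L (n-1)) h1 hw h2.symm hc.1.symm
      (fun h => by have := inj h; omega))
  have surj : Function.Surjective L := by
    intro v
    obtain ⟨wk⟩ := hG.1.preconnected (L 0) v
    have : ∀ a b, G.Walk a b → (∃ n, L n = a) → ∃ n, L n = b := by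
      intro a b wk
      induction wk with
      | nil => exact id
      | cons hadj _ ih =>
        rintro ⟨n, rfl⟩
        apply ih
        rcases nb n _ hadj with h | h
        · exact ⟨_, h.symm⟩
        · exact ⟨_, h.symm⟩
    exact this _ _ wk ⟨0, rfl⟩
  refine ⟨RelIso.symm ⟨Equiv.ofBijective L ⟨inj, surj⟩, ?_⟩⟩
  intro m n
  show G.Adj (L m) (L n) ↔ zline.Adj m n
  unfold zline
  rw [SimpleGraph.fromRel_adj]
  constructor
  · intro h
    refine ⟨fun e => by subst e; exact G.loopless.irrefl _ h, ?_⟩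
    rcases nb m _ h with h | h <;> have := inj h
    · exact Or.inl this
    · right; omega
  · rintro ⟨-, rfl | rfl⟩
    · exact La m
    · exact (La n).symm

theorem branch (hG : IsCCC G) (hne : NoExtremal G) (hnt : Nontrivial V)
    (hnl : ¬ Nonempty (G ≃g zline)) :
    ∃ p q r s : V, G.Adj p q ∧ G.Adj p r ∧ G.Adj p s ∧ q ≠ s ∧ r ≠ s ∧
      edgeHalf G p r ⊆ (edgeHalf G p q)ᶜ := by
  obtain ⟨p, a, b, c, ha, hb, hc, hab, hac, hbc⟩ := branch3 hG hne hnt hnl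
  obtain ⟨r, hr, hra, hr2⟩ := opp_edge hG hne ha
  by_cases h : r = b
  · exact ⟨p, a, r, c, ha, hr, hc, hac, by rw [h]; exact hbc, hr2⟩
  · exact ⟨p, a, r, b, ha, hr, hb, hab, h, hr2⟩

/-- three straight points centered at `p`, two of which are opposite -/
theorem tripod_exists (hG : IsCCC G) (hne : NoExtremal G) (hnt : Nontrivial V)
    (hnl : ¬ Nonempty (G ≃g zline)) :
    ∃ p, ∃ x y z : Bdry G, Str G p x.1 ∧ Str G p y.1 ∧ Str G p z.1 ∧
      grom G p x.1 y.1 = 0 ∧ grom G p y.1 z.1 = 0 ∧ grom G p x.1 z.1 = 0 ∧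
      ∀ u : Bdry G, grom G p x.1 u.1 = 0 ∨ grom G p y.1 u.1 = 0 := by
  obtain ⟨p, q, r, s, hq, hr, hs, hqs, hrs, hqr⟩ := branch hG hne hnt hnl
  obtain ⟨x, sx, x1, x2⟩ := E_lemma hG hne hq
  obtain ⟨y, sy, y1, y2⟩ := E_lemma hG hne hr
  obtain ⟨z, sz, z1, z2⟩ := E_lemma hG hne hs
  have aux : ∀ {q x z}, G.Adj p q → Str G p z → edgeHalf G p q ∈ x →
      (∀ h ∈ x, p ∉ h → h ⊆ edgeHalf G p q) → edgeHalf G p s ∈ z → q ≠ s → grom G p x z = 0 := by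
    intro q x z hq hz hx1 hx2 hsz hqs
    by_contra hc
    have := (grom_E hG hq hz.1.1 hx1 hx2).1 hc
    exact hqs (Str_adj_unique hG hz hq hs this hsz)
  have op : ∀ u, IsUltra G u → grom G p x u = 0 ∨ grom G p y u = 0 := by
    intro u hu
    by_contra hc
    push Not at hc
    have h1 := (grom_E hG hq hu x1 x2).1 hc.1
    have h2 := (grom_E hG hr hu y1 y2).1 hc.2
    exact ultra_not hu h2 h1 hqr
  refine ⟨p, ⟨x, sx.1⟩, ⟨y, sy.1⟩, ⟨z, sz.1⟩, sx, sy, sz, ?_, ?_, ?_, fun u => op u.1 u.2.1⟩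
  · have := op y sy.1.1
    rw [self_top hG sy.1] at this
    simpa using this
  · exact aux hr sz y1 y2 z1 hrs
  · exact aux hq sz x1 x2 z1 hqs

end CCCRP

namespace CCCRP
variable {V V' : Type*} {G : SimpleGraph V} {G' : SimpleGraph V'}

theorem op_image {f : Bdry G ≃ Bdry G'} (hG' : IsCCC G') (hne' : NoExtremal G')
    {p' : V'} {x y z : Bdry G'}
    (c1 : grom G' p' x.1 y.1 = 0) (c2 : grom G' p' y.1 z.1 = 0) (c3 : grom G' p' x.1 z.1 = 0)
    (key : ∀ u : Bdry G, grom G' p' y.1 (f u).1 = 1 → grom G' p' z.1 (f u).1 = 0 →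
      grom G' p' x.1 (f u).1 = 0) (w : Bdry G') :
    grom G' p' x.1 w.1 = 0 ∨ grom G' p' y.1 w.1 = 0 := by
  by_contra hc
  push Not at hc
  obtain ⟨p1, a1, hx, hw⟩ := grom_adj hG' x.2.1 w.2.1 hc.1
  obtain ⟨p2, a2, ky, kw⟩ := grom_adj hG' y.2.1 w.2.1 hc.2
  have hne12 : p1 ≠ p2 := by
    rintro rfl
    exact eh_left (grom_zero.1 c1 _ hx ky)
  obtain ⟨w0, hw1, hw2⟩ := w.2.1.2.2 _ hw _ kw
  obtain ⟨p3, d1, d2, d3⟩ := square_of_inter hG' a1 a2 hne12 hw1 hw2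
  have e1 := square_half hG' a1 a2 hne12 d1 d2 d3
  have e2 := square_half hG' a2 a1 hne12.symm d1 d3 d2
  obtain ⟨t, st, t1, t2⟩ := O_lemma hG' hne' d3.symm
  rw [← eh_compl hG' d3, e2, compl_compl] at t1
  have ht : edgeHalf G' p' p1 ∈ t := by
    by_contra h
    have h1 := ultra_compl st.1.1 (eh_hs a1) h
    rw [← eh_compl hG' d3, e2] at t2
    exact t2 h1
  have kt : edgeHalf G' p' p2 ∈ t := by
    by_contra h
    have h1 := ultra_compl st.1.1 (eh_hs a2) h
    have h2 := t1 _ h1 (by rw [← e1]; simpa using eh_right d2)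
    exact eh_left (h2 (show p' ∈ (edgeHalf G' p' p2)ᶜ from eh_left))
  have tri : ∀ m ∈ t, p' ∉ m → m ⊆ edgeHalf G' p' p1 ∨ m = edgeHalf G' p' p2 := by
    intro m hm hp
    by_cases h3 : p3 ∈ m
    · by_cases h1 : p1 ∈ m
      · left; exact (hs_cross hG' (st.1.1.1 m hm) a1 hp h1).subset
      · right; rw [← e1]; exact hs_cross hG' (st.1.1.1 m hm) d2 h1 h3
    · exact Or.inl (t1 m hm h3)
  obtain ⟨u, hu⟩ := f.surjective ⟨t, st.1⟩
  have hu' : (f u).1 = t := by rw [hu]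
  have := key u ?_ ?_
  · rw [hu'] at this
    exact eh_left (grom_zero.1 this _ hx ht)
  · rw [hu']
    unfold grom
    rw [encard_eq_one]
    refine ⟨edgeHalf G' p' p2, Subset.antisymm ?_ ?_⟩
    · rintro m ⟨m1, m2, m3⟩
      rcases tri m m2 m3 with h | h
      · have := ultra_up y.2.1 m1 (eh_hs a1) h
        exact absurd (grom_zero.1 c1 _ hx this) eh_left
      · exact h
    · rintro m rfl
      exact ⟨ky, kt, eh_left⟩
  · rw [hu', grom_zero]
    intro m m1 m2
    by_contra m3
    rcases tri m m2 m3 with h | h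
    · have := ultra_up z.2.1 m1 (eh_hs a1) h
      exact eh_left (grom_zero.1 c3 _ hx this)
    · rw [h] at m1
      exact eh_left (grom_zero.1 c2 _ ky m1)

theorem base {f : Bdry G ≃ Bdry G'} (hG : IsCCC G) (hne : NoExtremal G) (hnt : Nontrivial V)
    (hnl : ¬ Nonempty (G ≃g zline)) (hG' : IsCCC G')
    (hne' : NoExtremal G') (hpp : PPpres G G' f) (hQ : Qpres G G' f)
    (hS : ∀ x y : Bdry G, ∀ p, Str G p x.1 → PP G' (f x).1 (f y).1 → PP G x.1 y.1) :
    ∃ p p', M G G' f p p' ∧ (∀ q', M G G' f p q' → q' = p') ∧ (∀ q, M G G' f q p' → q = p) := by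
  obtain ⟨p, x, y, z, sx, sy, sz, hxy, hyz, hxz, op⟩ := tripod_exists hG hne hnt hnl
  have pxy : PP G x.1 y.1 := PP_of_zero hG x.2.1 y.2.1 hxy
  have pyz : PP G y.1 z.1 := PP_of_zero hG y.2.1 z.2.1 hyz
  have pxz : PP G x.1 z.1 := PP_of_zero hG x.2.1 z.2.1 hxz
  obtain ⟨p', hxy', hyz', hxz'⟩ := center_exists hG' (f x).2.1 (f y).2.1 (f z).2.1
    (hpp _ _ pxy) (hpp _ _ pyz) (hpp _ _ pxz)
  have rel : ∀ x1 x2 x3 u : Bdry G, PP G x1.1 x3.1 → PP G x2.1 x3.1 → grom G p x1.1 x3.1 = 0 →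
      grom G p x2.1 x3.1 = 0 → grom G' p' (f x1).1 (f x3).1 = 0 →
      grom G' p' (f x2).1 (f x3).1 = 0 → PP G x1.1 u.1 → PP G x2.1 u.1 →
      grom G p x1.1 u.1 + grom G' p' (f x2).1 (f u).1 =
        grom G' p' (f x1).1 (f u).1 + grom G p x2.1 u.1 := by
    intro x1 x2 x3 u h1 h2 h3 h4 h5 h6 h7 h8
    have := hQ x1 x2 u x3 h7 h2 h1 h8 p p'
    rw [h3, h4, h5, h6] at this
    simpa using this
  have cm : ∀ {v : V} {x y : Bdry G}, grom G v x.1 y.1 = 0 → grom G v y.1 x.1 = 0 := by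
    intro v x y h; rwa [grom_comm]
  have cm' : ∀ {v : V'} {x y : Bdry G'}, grom G' v x.1 y.1 = 0 → grom G' v y.1 x.1 = 0 := by
    intro v x y h; rwa [grom_comm]
  have op' : ∀ w : Bdry G', grom G' p' (f x).1 w.1 = 0 ∨ grom G' p' (f y).1 w.1 = 0 := by
    refine op_image (f := f) hG' hne' hxy' hyz' hxz' ?_
    intro u hb hc
    have hyu : PP G y.1 u.1 := hS y u p sy
      (PP_of hG' (f y).2.1 (f u).2.1 (p := p') (by rw [hb]; simp))
    have hzu : PP G z.1 u.1 := hS z u p sz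
      (PP_of hG' (f z).2.1 (f u).2.1 (p := p') (by rw [hc]; simp))
    have r1 := rel y z x u (PP_comm pxy) (PP_comm pxz) (cm hxy) (cm hxz) (cm' hxy') (cm' hxz')
      hyu hzu
    rw [hb, hc] at r1
    have hb0 : grom G p y.1 u.1 ≠ 0 := by
      intro h; rw [h, zero_add] at r1; exact one_ne_zero (add_eq_zero.1 r1.symm).1
    have ha0 := (op u).resolve_right hb0
    have hxu : PP G x.1 u.1 := PP_of_zero hG x.2.1 u.2.1 ha0
    have r2 := rel z x y u (PP_comm pyz) pxy (cm hyz) hxy (cm' hyz') hxy' hzu hxu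
    rw [hc, ha0] at r2
    simp at r2
    exact r2.2
  have tops : ∀ x0 u : Bdry G, Str G p x0.1 → ¬ PP G x0.1 u.1 → grom G p x0.1 u.1 = ⊤ ∧
      grom G' p' (f x0).1 (f u).1 = ⊤ := by
    intro x0 u s0 h
    exact ⟨top_of_not_PP hG x0.2.1 u.2.1 h p,
      top_of_not_PP hG' (f x0).2.1 (f u).2.1 (fun h' => h (hS x0 u p s0 h')) p'⟩
  have ab : ∀ u : Bdry G, grom G p x.1 u.1 = grom G' p' (f x).1 (f u).1 ∧
      grom G p y.1 u.1 = grom G' p' (f y).1 (f u).1 := by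
    intro u
    have o1 := op u
    have o2 := op' (f u)
    by_cases hx : PP G x.1 u.1
    · by_cases hy : PP G y.1 u.1
      · have r := rel x y z u pxz pyz hxz hyz hxz' hyz' hx hy
        have k1 := hx p
        have k2 := hy p
        have k3 := hpp _ _ hx p'
        have k4 := hpp _ _ hy p'
        generalize grom G p x.1 u.1 = a at *
        generalize grom G p y.1 u.1 = b at *
        generalize grom G' p' (f x).1 (f u).1 = a' at *
        generalize grom G' p' (f y).1 (f u).1 = b' at *
        lift a to ℕ using k1
        lift b to ℕ using k2
        lift a' to ℕ using k3
        lift b' to ℕ using k4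
        norm_cast at *
        omega
      · obtain ⟨h1, h2⟩ := tops y u sy hy
        rw [h1] at o1
        rw [h2] at o2
        simp at o1 o2
        rw [h1, h2, o1, o2]; simp
    · obtain ⟨h1, h2⟩ := tops x u sx hx
      rw [h1] at o1
      rw [h2] at o2
      simp at o1 o2
      rw [h1, h2, o1, o2]; simp
  have fin : ∀ w w' : Bdry G, PP G w.1 w'.1 → PP G x.1 w.1 → PP G y.1 w'.1 →
      grom G p w.1 w'.1 = grom G' p' (f w).1 (f w').1 := by
    intro w w' hww hx hy
    have q := hQ x w' y w pxy (PP_comm hww) hx (PP_comm hy) p p'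
    have k1 := hx p
    have k2 := hy p
    rw [hxy, hxy', ← (ab w).1, grom_comm p' (f w').1 (f y).1, ← (ab w').2,
      grom_comm p w'.1 y.1, zero_add, zero_add, grom_comm p w'.1, grom_comm p' (f w').1] at q
    exact ENat.add_left_injective_of_ne_top (by simp [k1, k2]) q
  have both : ∀ x0 w w' : Bdry G, Str G p x0.1 → PP G w.1 w'.1 → ¬ PP G x0.1 w.1 →
      ¬ PP G x0.1 w'.1 → False := by
    intro x0 w w' s0 hww h1 h2
    have c1 := C_lemma hG s0 w.2.1 (tops x0 w s0 h1).1
    have c2 := C_lemma hG s0 w'.2.1 (tops x0 w' s0 h2).1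
    have h3 := self_top hG x0.2 p
    apply hww p
    rw [eq_top_iff, ← h3]
    unfold grom
    apply encard_le_encard
    rintro k ⟨k1, -, k3⟩
    exact ⟨c1 k k1 k3, c2 k k1 k3, k3⟩
  have noxy : ∀ w : Bdry G, PP G x.1 w.1 ∨ PP G y.1 w.1 := by
    intro w
    rcases op w with h | h
    · exact Or.inl (PP_of_zero hG x.2.1 w.2.1 h)
    · exact Or.inr (PP_of_zero hG y.2.1 w.2.1 h)
  refine ⟨p, p', ?_, ?_, ?_⟩
  · intro w w' hww
    by_cases h1 : PP G x.1 w.1 <;> by_cases h2 : PP G y.1 w'.1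
    · exact fin w w' hww h1 h2
    · by_cases h3 : PP G y.1 w.1
      · have := fin w' w (PP_comm hww) ((noxy w').resolve_right h2) h3
        rwa [grom_comm p, grom_comm p'] at this
      · exact (both y w w' sy hww h3 h2).elim
    · by_cases h3 : PP G x.1 w'.1
      · have := fin w' w (PP_comm hww) h3 ((noxy w).resolve_left h1)
        rwa [grom_comm p, grom_comm p'] at this
      · exact (both x w w' sx hww h1 h3).elim
    · have := fin w' w (PP_comm hww) ((noxy w').resolve_right h2) ((noxy w).resolve_left h1)
      rwa [grom_comm p, grom_comm p'] at this
  · intro q' hq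
    refine center_unique hG' (f x).2.1 (f y).2.1 (f z).2.1 ?_ ?_ ?_ hxy' hyz' hxz'
    · rw [← hq x y pxy, hxy]
    · rw [← hq y z pyz, hyz]
    · rw [← hq x z pxz, hxz]
  · intro q hq
    refine center_unique hG x.2.1 y.2.1 z.2.1 ?_ ?_ ?_ hxy hyz hxz
    · rw [hq x y pxy, hxy']
    · rw [hq y z pyz, hyz']
    · rw [hq x z pxz, hxz']

end CCCRP

namespace CCCRP
variable {V V' : Type*} {G : SimpleGraph V} {G' : SimpleGraph V'}

/-- matched vertices have matched edges -/
def Edg (G : SimpleGraph V) (G' : SimpleGraph V') (f : Bdry G → Bdry G') : Prop :=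
  ∀ p q p', M G G' f p p' → G.Adj p q → ∃ q', G'.Adj p' q' ∧
    (∀ u : Bdry G, edgeHalf G p q ∈ u.1 ↔ edgeHalf G' p' q' ∈ (f u).1) ∧ M G G' f q q'

theorem edg_of {f : Bdry G ≃ Bdry G'} (hG : IsCCC G) (hne : NoExtremal G) (hG' : IsCCC G')
    (hne' : NoExtremal G') (hpp : PPpres G G' f) (hR : Rpres G G' f)
    (hS : ∀ x y : Bdry G, ∀ p, Str G p x.1 → PP G' (f x).1 (f y).1 → PP G x.1 y.1) :
    Edg G G' f := by
  intro p q p' hM hpq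
  obtain ⟨q', h1, h2⟩ := edge_lemma hG hne hG' hne' hR hS hM hpq
  exact ⟨q', h1, h2, match_M hG hG' hpp hM hpq h1 h2⟩

theorem pp_full {f : Bdry G ≃ Bdry G'} (hG : IsCCC G) (hG' : IsCCC G') (hE : Edg G G' f)
    {p : V} {p' : V'} (hM : M G G' f p p') (w w' : Bdry G)
    (h : PP G' (f w).1 (f w').1) : PP G w.1 w'.1 := by
  have key : ∀ n : ℕ, ∀ p p', M G G' f p p' → (n : ℕ∞) ≤ grom G p w.1 w'.1 →
      (n : ℕ∞) ≤ grom G' p' (f w).1 (f w').1 := by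
    intro n
    induction n with
    | zero => intros; simp
    | succ n ih =>
      intro p p' hM hn
      have h0 : grom G p w.1 w'.1 ≠ 0 := by
        intro h; rw [h] at hn; simp at hn
      obtain ⟨q, hq, q1, q2⟩ := grom_adj hG w.2.1 w'.2.1 h0
      obtain ⟨q', hq', hm, hM'⟩ := hE p q p' hM hq
      rw [grom_step1 hG hq w.2.1 w'.2.1 q1 q2] at hn
      rw [grom_step1 hG' hq' (f w).2.1 (f w').2.1 ((hm w).1 q1) ((hm w').1 q2)]
      push_cast at hn ⊢
      have := ih q q' hM' ((ENat.add_le_add_iff_right (by simp)).1 hn)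
      gcongr
  by_contra hn
  have ht := top_of_not_PP hG w.2.1 w'.2.1 hn p
  have h1 := h p'
  have h2 := fun n : ℕ => key n p p' hM (by rw [ht]; exact le_top)
  lift grom G' p' (f w).1 (f w').1 to ℕ using h1 with m hm
  have := h2 (m+1)
  norm_cast at this
  omega

theorem uniq_prop {f : Bdry G ≃ Bdry G'} (hG : IsCCC G) (hG' : IsCCC G') (hne' : NoExtremal G')
    (hE : Edg G G' f) {p : V}
    (h : ∃ p', M G G' f p p' ∧ ∀ q', M G G' f p q' → q' = p') :
    ∀ q, ∃ q', M G G' f q q' ∧ ∀ r', M G G' f q r' → r' = q' := by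
  have step : ∀ p q, G.Adj p q → (∃ p', M G G' f p p' ∧ ∀ q', M G G' f p q' → q' = p') →
      ∃ q', M G G' f q q' ∧ ∀ r', M G G' f q r' → r' = q' := by
    rintro p q hpq ⟨p', hp, hu⟩
    obtain ⟨q', a1, a2, a3⟩ := hE p q p' hp hpq
    refine ⟨q', a3, fun r' hr => ?_⟩
    obtain ⟨s, b1, b2, b3⟩ := hE q p r' hr hpq.symm
    obtain rfl := hu s b3
    refine match_unique (f := f) hG' hne' b1.symm a1 fun u => ?_
    rw [← a2, ← not_iff_not, ← ultra_compl_iff hG' (f u).2.1 b1.symm, ← b2,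
      ultra_compl_iff hG u.2.1 hpq]
  intro q
  obtain ⟨wk⟩ := hG.1.preconnected p q
  induction wk with
  | nil => exact h
  | cons hadj _ ih => exact ih (step _ _ hadj h)

theorem iso_dist_le (hG : IsCCC G) (F : G ≃g G') (u v : V) :
    G'.dist (F u) (F v) ≤ G.dist u v := by
  obtain ⟨wk, hw⟩ := hG.1.exists_walk_length_eq_dist u v
  have := G'.dist_le (wk.map F.toHom)
  rw [SimpleGraph.Walk.length_map, hw] at this
  exact this

theorem iso_dist (hG : IsCCC G) (hG' : IsCCC G') (F : G ≃g G') (u v : V) :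
    G'.dist (F u) (F v) = G.dist u v := by
  refine le_antisymm (iso_dist_le hG F u v) ?_
  have := iso_dist_le hG' F.symm (F u) (F v)
  simpa using this

theorem iso_eh (hG : IsCCC G) (hG' : IsCCC G') (F : G ≃g G') (u v : V) : F '' edgeHalf G u v = edgeHalf G' (F u) (F v) := by
  ext w
  constructor
  · rintro ⟨a, ha, rfl⟩
    rw [mem_eh] at *
    rwa [iso_dist hG hG', iso_dist hG hG']
  · intro hw
    obtain ⟨a, rfl⟩ := F.surjective w
    refine ⟨a, ?_, rfl⟩
    rw [mem_eh] at *
    rwa [iso_dist hG hG', iso_dist hG hG'] at hw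

theorem iso_grom (F : G ≃g G') (p : V) (w w' : Set (Set V)) :
    grom G' (F p) (mapUltra F w) (mapUltra F w') = grom G p w w' := by
  unfold grom
  have hi : Function.Injective (fun h : Set V => F '' h) := image_injective.2 F.injective
  rw [← hi.encard_image]
  congr 1
  ext k
  constructor
  · rintro ⟨⟨h, h1, rfl⟩, ⟨h', h2, h3⟩, h4⟩
    obtain rfl := hi h3
    exact ⟨h', ⟨h1, h2, fun hp => h4 ⟨p, hp, rfl⟩⟩, rfl⟩
  · rintro ⟨h, ⟨h1, h2, h3⟩, rfl⟩
    refine ⟨⟨h, h1, rfl⟩, ⟨h, h2, rfl⟩, ?_⟩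
    rintro ⟨a, ha, hb⟩
    exact h3 (F.injective hb ▸ ha)

theorem main (hG : IsCCC G) (hG' : IsCCC G')
    (hnt : Nontrivial V) (hne : NoExtremal G) (hne' : NoExtremal G')
    (hnl : ¬ Nonempty (G ≃g zline))
    (f : Bdry G ≃ Bdry G') (hmob : Mobius G G' f) :
    ∃! F : G ≃g G', ∀ x : Bdry G, mapUltra ⇑F x.1 = (f x).1 := by
  have hpp := mob_pp hG' hmob
  have hQ := mob_q hG' hmob
  have hR := mob_r hG hG' hmob
  have hS : ∀ x y : Bdry G, ∀ p, Str G p x.1 → PP G' (f x).1 (f y).1 → PP G x.1 y.1 :=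
    fun x y p hx h => claim2 hG hne hG' hR hx h
  have hE := edg_of hG hne hG' hne' hpp hR hS
  obtain ⟨p0, p0', hM0, hu0, hu0'⟩ := base hG hne hnt hnl hG' hne' hpp hQ hS
  have full := pp_full hG hG' hE hM0
  have full' : ∀ w w' : Bdry G', PP G (f.symm w).1 (f.symm w').1 → PP G' w.1 w'.1 := by
    intro w w' h
    have := hpp _ _ h
    simpa using this
  have hpp' : PPpres G' G f.symm := by
    intro w w' h
    exact full _ _ (by simpa using h)
  have hE' : Edg G' G f.symm := edg_of hG' hne' hG hne hpp'
    (fun x y _ _ _ _ _ _ _ h => full' x y h) (fun x y _ _ h => full' x y h)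
  have Msymm : ∀ p p', M G G' f p p' → M G' G f.symm p' p := by
    intro p p' h w w' hw
    have := h (f.symm w) (f.symm w') (hpp' _ _ hw)
    simpa using this.symm
  have Msymm' : ∀ p p', M G' G f.symm p' p → M G G' f p p' := by
    intro p p' h w w' hw
    have := h (f w) (f w') (hpp _ _ hw)
    simpa using this.symm
  have ex := uniq_prop hG hG' hne' hE ⟨p0', hM0, hu0⟩
  have ex' := uniq_prop hG' hG hne hE' ⟨p0, Msymm _ _ hM0, fun q hq => hu0' q (Msymm' _ _ hq)⟩
  choose F hF hFu using ex
  choose K hK hKu using ex'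
  have KF : ∀ p, K (F p) = p := fun p => (hKu _ _ (Msymm _ _ (hF p))).symm
  have FK : ∀ p', F (K p') = p' := fun p' => (hFu _ _ (Msymm' _ _ (hK p'))).symm
  have adj : ∀ p q, G.Adj p q → G'.Adj (F p) (F q) ∧
      ∀ u : Bdry G, edgeHalf G p q ∈ u.1 ↔ edgeHalf G' (F p) (F q) ∈ (f u).1 := by
    intro p q hpq
    obtain ⟨q', a1, a2, a3⟩ := hE p q (F p) (hF p) hpq
    obtain rfl := hFu _ _ a3
    exact ⟨a1, a2⟩
  have adj' : ∀ p q, G'.Adj p q → G.Adj (K p) (K q) := by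
    intro p q hpq
    obtain ⟨q', a1, a2, a3⟩ := hE' p q (K p) (hK p) hpq
    obtain rfl := hKu _ _ a3
    exact a1
  let Fi : G ≃g G' := ⟨⟨F, K, KF, FK⟩, by
    intro a b
    refine ⟨fun h => ?_, fun h => (adj a b h).1⟩
    have := adj' _ _ h
    simpa [KF] using this⟩
  have hFi : ∀ p, Fi p = F p := fun p => rfl
  refine ⟨Fi, ?_, ?_⟩
  · intro x
    apply Subset.antisymm
    · rintro k ⟨h, hx, rfl⟩
      obtain ⟨u, v, huv, rfl⟩ := x.2.1.1 h hx
      have e := iso_eh hG hG' Fi u v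
      have := ((adj u v huv).2 x).1 hx
      show Fi '' edgeHalf G u v ∈ _
      rw [e]; exact this
    · intro k hk
      obtain ⟨u', v', huv, rfl⟩ := (f x).2.1.1 k hk
      have h1 := adj' _ _ huv
      have e := iso_eh hG hG' Fi (K u') (K v')
      rw [hFi, hFi, FK, FK] at e
      have h2 := (adj _ _ h1).2 x
      rw [FK, FK] at h2
      exact ⟨_, h2.2 hk, e⟩
  · intro F2 hF2
    ext p
    rw [hFi]
    apply hFu
    intro w w' _
    rw [← hF2, ← hF2, iso_grom]

end CCCRP

/-- Main Theorem: if `X` and `Y` have no extremal vertices, at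
least two vertices each, and neither is isomorphic to the standard cubulation of
ℝ, then every Möbius bijection `f : ∂X → ∂Y` extends to a unique cubical
isomorphism `F : X → Y`, i.e. the induced map on Roller compactifications
restricts to `f` on `∂X`. -/
theorem stmt18 {V V' : Type*} (G : SimpleGraph V) (G' : SimpleGraph V')
    (hG : IsCCC G) (hG' : IsCCC G')
    (hnt : Nontrivial V) (hnt' : Nontrivial V')
    (hne : NoExtremal G) (hne' : NoExtremal G')
    (hnl : ¬ Nonempty (G ≃g zline)) (hnl' : ¬ Nonempty (G' ≃g zline))
    (f : Bdry G → Bdry G') (hbij : Function.Bijective f) (hmob : Mobius G G' f) :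
    ∃! F : G ≃g G', ∀ x : Bdry G, mapUltra ⇑F x.1 = (f x).1 := by
  exact CCCRP.main hG hG' hnt hne hne' hnl (Equiv.ofBijective f hbij) hmob
end
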